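/- None of the pairs (13,39), (14,42), (14,44), (15,47), (18,54), (19,57) belongs to E^6; that is, for each such pair (p, q) there is no 6-polytope with p vertices and q edges. -/

import Mathlib

open Set

/-- A polytope: the convex hull of a finite set of points. -/
def IsPolytope {n : ℕ} (P : Set (Fin n → ℝ)) : Prop :=
  ∃ S : Finset (Fin n → ℝ), P = convexHull ℝ (S : Set (Fin n → ℝ))

/-- The affine dimension of a set: the rank of its vector span. -/
noncomputable def adim {n : ℕ} (P : Set (Fin n → ℝ)) : ℕ :=
  Module.finrank ℝ (vectorSpan ℝ P)

/-- A `d`-polytope: a polytope whose affine hull has dimension `d`. -/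
def IsDPolytope (d : ℕ) {n : ℕ} (P : Set (Fin n → ℝ)) : Prop :=
  IsPolytope P ∧ adim P = d

/-- An edge of `P`: a face (an extreme convex subset) of affine dimension 1. -/
def IsEdge {n : ℕ} (P E : Set (Fin n → ℝ)) : Prop :=
  IsExtreme ℝ P E ∧ Convex ℝ E ∧ adim E = 1

/-- `f₀ P`: the number of vertices (extreme points) of `P`. -/
noncomputable def f₀ {n : ℕ} (P : Set (Fin n → ℝ)) : ℕ :=
  (Set.extremePoints ℝ P).ncard

/-- `f₁ P`: the number of edges of `P`. -/
noncomputable def f₁ {n : ℕ} (P : Set (Fin n → ℝ)) : ℕ :=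
  {E : Set (Fin n → ℝ) | IsEdge P E}.ncard

/-- `E^d`: the set of `(f₀, f₁)` pairs realized by `d`-polytopes. -/
def fPairs (d : ℕ) : Set (ℕ × ℕ) :=
  {p | ∃ (n : ℕ) (P : Set (Fin n → ℝ)), IsDPolytope d P ∧ f₀ P = p.1 ∧ f₁ P = p.2}

namespace VPoly

open Module
open scoped Classical

section Geometry

variable {E : Type*} [AddCommGroup E] [Module ℝ E]

/-- `F` is the set of points of the finite set `V` at which some linear functional attains a given
upper bound on `V`. -/
def IsFace (V F : Finset E) : Prop :=
  ∃ (φ : E →ₗ[ℝ] ℝ) (c : ℝ), (∀ x ∈ V, φ x ≤ c) ∧ ∀ x, x ∈ F ↔ x ∈ V ∧ φ x = c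

/-- Every point of `V` is a face of `V`. -/
def ConvPos (V : Finset E) : Prop := ∀ v ∈ V, IsFace V {v}

/-- The affine dimension of a finite set of points. -/
noncomputable def dim (V : Finset E) : ℕ := finrank ℝ (vectorSpan ℝ (V : Set E))

/-- The neighbours of `v` in the graph of `V`. -/
noncomputable def nb (V : Finset E) (v : E) : Finset E :=
  V.filter fun w => w ≠ v ∧ IsFace V {v, w}

/-- The faces of codimension one. -/
noncomputable def facets (V : Finset E) : Finset (Finset E) :=
  V.powerset.filter fun F => IsFace V F ∧ dim F + 1 = dim V

variable {V F G H R : Finset E} {v w x : E}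

theorem mem_nb : w ∈ nb V v ↔ w ∈ V ∧ w ≠ v ∧ IsFace V {v, w} := by
  simp [nb]

theorem IsFace.subset (h : IsFace V F) : F ⊆ V := by
  obtain ⟨φ, c, -, h⟩ := h
  exact fun x hx => ((h x).1 hx).1

theorem mem_facets : F ∈ facets V ↔ IsFace V F ∧ dim F + 1 = dim V := by
  simp only [facets, Finset.mem_filter, Finset.mem_powerset]
  exact ⟨fun h => h.2, fun h => ⟨h.1.subset, h⟩⟩

theorem isFace_self (V : Finset E) : IsFace V V := ⟨0, 0, by simp, by simp⟩

theorem IsFace.inter (hF : IsFace V F) (hG : IsFace V G) : IsFace V (F ∩ G) := by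
  obtain ⟨φ, c, h1, h2⟩ := hF
  obtain ⟨ψ, e, h3, h4⟩ := hG
  refine ⟨φ + ψ, c + e, fun x hx => ?_, fun x => ?_⟩
  · have := h1 x hx
    have := h3 x hx
    simp only [LinearMap.add_apply]
    linarith
  · rw [Finset.mem_inter, h2, h4]
    simp only [LinearMap.add_apply]
    constructor
    · rintro ⟨⟨h, e1⟩, -, e2⟩
      exact ⟨h, by rw [e1, e2]⟩
    · rintro ⟨h, e1⟩
      have := h1 x h
      have := h3 x h
      exact ⟨⟨h, by linarith⟩, h, by linarith⟩

theorem IsFace.restrict (hF : IsFace V F) (h : F ⊆ G) (hG : G ⊆ V) : IsFace G F := by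
  obtain ⟨φ, c, h1, h2⟩ := hF
  refine ⟨φ, c, fun x hx => h1 x (hG hx), fun x => ?_⟩
  constructor
  · exact fun hx => ⟨h hx, ((h2 x).1 hx).2⟩
  · exact fun hx => (h2 x).2 ⟨hG hx.1, hx.2⟩

theorem IsFace.trans (hF : IsFace V F) (hG : IsFace F G) : IsFace V G := by
  have hGF := hG.subset
  obtain ⟨φ, c, h1, h2⟩ := hF
  obtain ⟨ψ, e, h3, h4⟩ := hG
  obtain ⟨M, hM⟩ := ((V \ F).image fun x => (ψ x - e) / (c - φ x)).exists_le
  have key : ∀ x ∈ V, φ x ≠ c → ((M + 1) • φ + ψ) x < (M + 1) * c + e := by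
    intro x hx hxc
    have hpos : 0 < c - φ x := by
      have := lt_of_le_of_ne (h1 x hx) hxc
      linarith
    have hle := hM _ (Finset.mem_image_of_mem _
      (Finset.mem_sdiff.2 ⟨hx, fun h => hxc ((h2 x).1 h).2⟩))
    rw [div_le_iff₀ hpos] at hle
    simp only [LinearMap.add_apply, LinearMap.smul_apply, smul_eq_mul]
    nlinarith
  refine ⟨(M + 1) • φ + ψ, (M + 1) * c + e, fun x hx => ?_, fun x => ⟨fun hx => ?_, ?_⟩⟩
  · by_cases hxc : φ x = c
    · have := h3 x ((h2 x).2 ⟨hx, hxc⟩)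
      simp only [LinearMap.add_apply, LinearMap.smul_apply, smul_eq_mul, hxc]
      linarith
    · exact (key x hx hxc).le
  · have hxF := (h2 x).1 (hGF hx)
    refine ⟨hxF.1, ?_⟩
    simp only [LinearMap.add_apply, LinearMap.smul_apply, smul_eq_mul, hxF.2, ((h4 x).1 hx).2]
  · rintro ⟨hx, hxe⟩
    by_cases hxc : φ x = c
    · refine (h4 x).2 ⟨(h2 x).2 ⟨hx, hxc⟩, ?_⟩
      simp only [LinearMap.add_apply, LinearMap.smul_apply, smul_eq_mul, hxc] at hxe
      linarith
    · exact absurd hxe (key x hx hxc).ne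

theorem ConvPos.of_face (hV : ConvPos V) (hF : IsFace V F) : ConvPos F := fun v hv =>
  (hV v (hF.subset hv)).restrict (by simpa using hv) hF.subset

theorem nb_subset : nb V v ⊆ V := Finset.filter_subset _ _

theorem notMem_nb_self : v ∉ nb V v := fun h => (mem_nb.1 h).2.1 rfl

theorem mem_nb_comm (hv : v ∈ V) : w ∈ nb V v → v ∈ nb V w := by
  rw [mem_nb, mem_nb, Finset.pair_comm]
  exact fun h => ⟨hv, h.2.1.symm, h.2.2⟩

theorem nb_face (hF : IsFace V F) (hv : v ∈ F) : nb F v = nb V v ∩ F := by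
  ext w
  rw [Finset.mem_inter, mem_nb, mem_nb]
  constructor
  · exact fun h => ⟨⟨hF.subset h.1, h.2.1, hF.trans h.2.2⟩, h.1⟩
  · exact fun h => ⟨h.2, h.1.2.1, h.1.2.2.restrict
      (by simp [Finset.insert_subset_iff, hv, h.2]) hF.subset⟩

theorem IsFace.vertex_functional (hV : ConvPos V) (hv : v ∈ V) :
    ∃ ψ : E →ₗ[ℝ] ℝ, ∀ x ∈ V, x ≠ v → ψ x < ψ v := by
  obtain ⟨ψ, c, h1, h2⟩ := hV v hv
  have hc : ψ v = c := ((h2 v).1 (by simp)).2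
  refine ⟨ψ, fun x hx hxv => lt_of_le_of_ne (hc ▸ h1 x hx) fun h => hxv ?_⟩
  simpa using (h2 x).2 ⟨hx, h.trans hc⟩

/-- Tilting a supporting hyperplane at `g` until it meets a further point. -/
theorem exists_tilt (φ χ : E →ₗ[ℝ] ℝ) {g : E} (h1 : ∀ x ∈ V, φ x ≤ φ g)
    (hx : ∃ x ∈ V, φ x < φ g) (h2 : ∀ x ∈ V, φ x = φ g → χ x = χ g) :
    ∃ t : ℝ, (∀ x ∈ V, χ x + t * φ x ≤ χ g + t * φ g) ∧
      ∃ x ∈ V, φ x < φ g ∧ χ x + t * φ x = χ g + t * φ g := by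
  obtain ⟨y, hy, hmax⟩ := (V.filter fun x => φ x < φ g).exists_max_image
    (fun x => (χ x - χ g) / (φ g - φ x)) (by
      obtain ⟨x, hxV, hx⟩ := hx
      exact ⟨x, by simp [hxV, hx]⟩)
  rw [Finset.mem_filter] at hy
  have hyp : 0 < φ g - φ y := by linarith [hy.2]
  refine ⟨(χ y - χ g) / (φ g - φ y), fun x hxV => ?_, y, hy.1, hy.2, ?_⟩
  · rcases (h1 x hxV).lt_or_eq with h | h
    · have := hmax x (by simp [hxV, h])
      rw [div_le_iff₀ (by linarith)] at this
      linarith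
    · rw [h2 x hxV h, h]
  · field_simp
    ring

theorem smul_sub_ne_smul_sub (hV : ConvPos V) (hv : v ∈ V) (hw : w ∈ V) (hx : x ∈ V) (hwv : w ≠ v)
    (hxv : x ≠ v) (hwx : w ≠ x) {a b : ℝ} (ha : 0 < a) (hb : 0 < b) :
    a • (w - v) ≠ b • (x - v) := by
  wlog hab : b ≤ a generalizing a b w x
  · exact fun h => this hx hw hxv hwv hwx.symm hb ha (le_of_not_ge hab) h.symm
  intro h
  obtain ⟨ψ, hψ⟩ := IsFace.vertex_functional hV hw
  have h1 := hψ v hv hwv.symm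
  have h2 := hψ x hx hwx.symm
  have h3 := congrArg ψ h
  simp only [map_smul, map_sub, smul_eq_mul] at h3
  nlinarith

theorem exists_nb_of_face (hV : ConvPos V) (hF : IsFace V F) (hv : v ∈ F) (hw : w ∈ F)
    (hwv : w ≠ v) : ∃ u ∈ nb V v, u ∈ F := by
  induction hn : F.card using Nat.strong_induction_on generalizing F w with
  | _ n ih =>
  subst hn
  by_cases hcase : ∃ x ∈ F, x ≠ v ∧ x ≠ w
  swap
  · push Not at hcase
    have : F = {v, w} := by
      ext x
      simp only [Finset.mem_insert, Finset.mem_singleton]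
      constructor
      · intro hx
        by_cases hxv : x = v
        · exact Or.inl hxv
        · exact Or.inr (hcase x hx hxv)
      · rintro (rfl | rfl) <;> assumption
    exact ⟨w, mem_nb.2 ⟨hF.subset hw, hwv, this ▸ hF⟩, hw⟩
  obtain ⟨x, hx, hxv, hxw⟩ := hcase
  have hF' := hV.of_face hF
  obtain ⟨ψ, hψ⟩ := IsFace.vertex_functional hF' hv
  have hw1 := hψ w hw hwv
  have hx1 := hψ x hx hxv
  have hne := smul_sub_ne_smul_sub hF' hv hw hx hwv hxv hxw.symm (a := ψ v - ψ x) (b := ψ v - ψ w)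
    (by linarith) (by linarith)
  obtain ⟨χ, hχ⟩ : ∃ χ : Module.Dual ℝ E,
      χ ((ψ v - ψ x) • (w - v) - (ψ v - ψ w) • (x - v)) ≠ 0 := by
    by_contra! h
    exact hne (sub_eq_zero.1 ((Module.forall_dual_apply_eq_zero_iff ℝ _).1 h))
  obtain ⟨t, ht, y, hy, hyv, hyt⟩ := exists_tilt (V := F) ψ χ (g := v)
    (fun z hz => by
      by_cases h : z = v
      · rw [h]
      · exact (hψ z hz h).le)
    ⟨w, hw, hw1⟩ (fun z hz h => by
      by_cases h' : z = v
      · rw [h']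
      · exact absurd h (hψ z hz h').ne)
  have hG : IsFace F (F.filter fun z => χ z + t * ψ z = χ v + t * ψ v) :=
    ⟨χ + t • ψ, χ v + t * ψ v, by simpa using ht, by simp⟩
  have hvG : v ∈ F.filter fun z => χ z + t * ψ z = χ v + t * ψ v := by simp [hv]
  have hyG : y ∈ F.filter fun z => χ z + t * ψ z = χ v + t * ψ v := by simp [hy, hyt]
  have hlt : (F.filter fun z => χ z + t * ψ z = χ v + t * ψ v).card < F.card := by
    apply Finset.card_lt_card
    refine (Finset.filter_subset _ _).ssubset_of_ne fun h => hχ ?_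
    have e1 : w ∈ F.filter fun z => χ z + t * ψ z = χ v + t * ψ v := h.symm ▸ hw
    have e2 : x ∈ F.filter fun z => χ z + t * ψ z = χ v + t * ψ v := h.symm ▸ hx
    simp only [Finset.mem_filter] at e1 e2
    simp only [map_smul, map_sub, smul_eq_mul]
    linear_combination (ψ v - ψ x) * e1.2 - (ψ v - ψ w) * e2.2
  obtain ⟨u, hu, huG⟩ := ih _ hlt (hF.trans hG) hvG hyG (by rintro rfl; exact lt_irrefl _ hyv) rfl
  exact ⟨u, hu, hG.subset huG⟩

/-- A local maximum of a linear functional on the graph is a global maximum. -/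
theorem le_of_forall_nb_le (hV : ConvPos V) (hv : v ∈ V) (φ : E →ₗ[ℝ] ℝ)
    (h : ∀ w ∈ nb V v, φ w ≤ φ v) {u : E} (hu : u ∈ V) : φ u ≤ φ v := by
  by_contra! hlt
  obtain ⟨ψ, hψ⟩ := IsFace.vertex_functional hV hv
  have huv : u ≠ v := by rintro rfl; exact lt_irrefl _ hlt
  obtain ⟨t, ht, y, hy, hyv, hyt⟩ := exists_tilt (V := V) ψ φ (g := v)
    (fun z hz => by
      by_cases h : z = v
      · rw [h]
      · exact (hψ z hz h).le)
    ⟨u, hu, hψ u hu huv⟩ (fun z hz h => by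
      by_cases h' : z = v
      · rw [h']
      · exact absurd h (hψ z hz h').ne)
  have hG : IsFace V (V.filter fun z => φ z + t * ψ z = φ v + t * ψ v) :=
    ⟨φ + t • ψ, φ v + t * ψ v, by simpa using ht, by simp⟩
  obtain ⟨w, hw, hwG⟩ := exists_nb_of_face hV hG (v := v) (w := y) (by simp [hv])
    (by simp [hy, hyt]) (by rintro rfl; exact lt_irrefl _ hyv)
  have h1 := h w hw
  have h2 := (Finset.mem_filter.1 hwG).2
  have h3 := hψ w (nb_subset hw) (mem_nb.1 hw).2.1
  have h4 := ht u hu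
  have h5 := hψ u hu huv
  have ht0 : 0 < t := by
    by_contra! h0
    nlinarith
  nlinarith

theorem exists_nb_gt (hV : ConvPos V) (hv : v ∈ V) (φ : E →ₗ[ℝ] ℝ) {u : E} (hu : u ∈ V)
    (h : φ v < φ u) : ∃ w ∈ nb V v, φ v < φ w := by
  by_contra! h'
  exact absurd (le_of_forall_nb_le hV hv φ h' hu) (not_le.2 h)

instance finiteDimensional_vectorSpan (V : Finset E) :
    FiniteDimensional ℝ (vectorSpan ℝ (V : Set E)) :=
  finiteDimensional_vectorSpan_of_finite ℝ V.finite_toSet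

theorem sub_mem_vectorSpan (hv : v ∈ V) (hw : w ∈ V) : w - v ∈ vectorSpan ℝ (V : Set E) :=
  vsub_mem_vectorSpan ℝ (Finset.mem_coe.2 hw) (Finset.mem_coe.2 hv)

theorem vectorSpan_le_iff (hv : v ∈ V) (W : Submodule ℝ E) :
    vectorSpan ℝ (V : Set E) ≤ W ↔ ∀ w ∈ V, w - v ∈ W := by
  rw [vectorSpan_eq_span_vsub_set_right ℝ (Finset.mem_coe.2 hv), Submodule.span_le]
  simp [Set.subset_def]

theorem vectorSpan_mono' (h : F ⊆ V) : vectorSpan ℝ (F : Set E) ≤ vectorSpan ℝ (V : Set E) :=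
  vectorSpan_mono ℝ (Finset.coe_subset.2 h)

theorem dim_mono (h : F ⊆ V) : dim F ≤ dim V := Submodule.finrank_mono (vectorSpan_mono' h)

theorem eq_of_mem_face {φ : E →ₗ[ℝ] ℝ} {c : ℝ} (h : ∀ x, x ∈ F ↔ x ∈ V ∧ φ x = c) {z : E}
    (hz : z ∈ vectorSpan ℝ (F : Set E)) : φ z = 0 := by
  have : vectorSpan ℝ (F : Set E) ≤ LinearMap.ker φ := by
    rcases F.eq_empty_or_nonempty with rfl | ⟨v, hv⟩
    · simp
    · rw [vectorSpan_le_iff hv]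
      intro w hw
      simp [((h w).1 hw).2, ((h v).1 hv).2]
  exact this hz

theorem dim_lt_of_ssubset (hF : IsFace V F) (hne : F.Nonempty) (h : F ⊂ V) : dim F < dim V := by
  refine (dim_mono h.subset).lt_of_ne fun heq => ?_
  have h1 := Submodule.eq_of_le_of_finrank_eq (vectorSpan_mono' h.subset) heq
  obtain ⟨φ, c, h2, h3⟩ := hF
  obtain ⟨v, hv⟩ := hne
  obtain ⟨x, hx, hxF⟩ := Finset.exists_of_ssubset h
  have := eq_of_mem_face h3 (h1 ▸ sub_mem_vectorSpan (h.subset hv) hx)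
  rw [map_sub, sub_eq_zero] at this
  exact hxF ((h3 x).2 ⟨hx, this.trans ((h3 v).1 hv).2⟩)

theorem IsFace.eq_of_dim_le (hF : IsFace V F) (hne : F.Nonempty) (h : dim V ≤ dim F) : F = V := by
  by_contra hn
  exact absurd (dim_lt_of_ssubset hF hne (hF.subset.ssubset_of_ne hn)) (not_lt.2 h)

theorem exists_dual_of_notMem {W : Submodule ℝ E} (hx : x ∉ W) :
    ∃ φ : E →ₗ[ℝ] ℝ, (∀ y ∈ W, φ y = 0) ∧ φ x ≠ 0 := by
  obtain ⟨φ, h1, h2⟩ := Submodule.exists_le_ker_of_notMem hx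
  exact ⟨φ, fun y hy => h2 hy, h1⟩

/-- A vertex of a face has enough neighbours outside the face. -/
theorem dim_le_dim_add_card (hV : ConvPos V) (hF : IsFace V F) (hv : v ∈ F) :
    dim V ≤ dim F + (nb V v \ F).card := by
  have hvV := hF.subset hv
  set T : Finset E := (nb V v \ F).image fun w => w - v with hT
  have hle : vectorSpan ℝ (V : Set E) ≤ vectorSpan ℝ (F : Set E) ⊔ Submodule.span ℝ (T : Set E) := by
    rw [vectorSpan_le_iff hvV]
    intro u hu
    by_contra hn
    obtain ⟨φ, h1, h2⟩ := exists_dual_of_notMem hn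
    have h3 : ∀ w ∈ nb V v, φ w = φ v := by
      intro w hw
      have : φ (w - v) = 0 := by
        apply h1
        by_cases hwF : w ∈ F
        · exact Submodule.mem_sup_left (sub_mem_vectorSpan hv hwF)
        · refine Submodule.mem_sup_right (Submodule.subset_span ?_)
          simp only [hT, Finset.coe_image]
          exact ⟨w, by simp [hw, hwF], rfl⟩
      rwa [map_sub, sub_eq_zero] at this
    have h4 := le_of_forall_nb_le hV hvV φ (fun w hw => (h3 w hw).le) hu
    have h5 := le_of_forall_nb_le hV hvV (-φ) (fun w hw => by simp [h3 w hw]) hu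
    simp only [LinearMap.neg_apply, neg_le_neg_iff] at h5
    exact h2 (by rw [map_sub, le_antisymm h4 h5, sub_self])
  calc dim V ≤ finrank ℝ ↥(vectorSpan ℝ (F : Set E) ⊔ Submodule.span ℝ (T : Set E)) :=
        Submodule.finrank_mono hle
    _ ≤ dim F + finrank ℝ (Submodule.span ℝ (T : Set E)) := Submodule.finrank_add_le_finrank_add_finrank _ _
    _ ≤ dim F + T.card := by gcongr; exact finrank_span_finset_le_card T
    _ ≤ _ := Nat.add_le_add_left (hT ▸ Finset.card_image_le) _

theorem dim_singleton : dim ({v} : Finset E) = 0 := by simp [dim]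

theorem dim_le_card_nb (hV : ConvPos V) (hv : v ∈ V) : dim V ≤ (nb V v).card := by
  have := dim_le_dim_add_card hV (hV v hv) (Finset.mem_singleton_self v)
  rw [dim_singleton, zero_add] at this
  exact this.trans (Finset.card_le_card Finset.sdiff_subset)

/-- A face of codimension at least two is the intersection of two larger faces. -/
theorem exists_two_faces (hF : IsFace V F) (hne : F.Nonempty) (hd : dim F + 2 ≤ dim V) :
    ∃ A B, IsFace V A ∧ IsFace V B ∧ F ⊂ A ∧ F ⊂ B ∧ A ∩ B = F := by
  obtain ⟨g, hg⟩ := hne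
  have hss : F ⊂ V := hF.subset.ssubset_of_ne (by rintro rfl; omega)
  obtain ⟨x₀, hx₀, hx₀F⟩ := Finset.exists_of_ssubset hss
  obtain ⟨φ, c, h1, h2⟩ := hF
  have hgc : φ g = c := ((h2 g).1 hg).2
  subst hgc
  have hgV : g ∈ V := hss.subset hg
  obtain ⟨y, hy, hyn⟩ : ∃ y ∈ V, y - g ∉ vectorSpan ℝ (F : Set E) ⊔ Submodule.span ℝ {x₀ - g} := by
    by_contra! h
    rw [← vectorSpan_le_iff hgV] at h
    have h3 := (Submodule.finrank_mono h).trans (Submodule.finrank_add_le_finrank_add_finrank _ _)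
    have h4 := finrank_span_le_card (R := ℝ) ({x₀ - g} : Set E)
    simp only [Set.toFinset_singleton, Finset.card_singleton] at h4
    unfold dim at hd
    omega
  obtain ⟨ψ, h3, h4⟩ := exists_dual_of_notMem hyn
  have hψF : ∀ x ∈ V, φ x = φ g → ψ x = ψ g := by
    intro x hx hxg
    have := h3 (x - g) (Submodule.mem_sup_left (sub_mem_vectorSpan hg ((h2 x).2 ⟨hx, hxg⟩)))
    rwa [map_sub, sub_eq_zero] at this
  have hψx : ψ x₀ = ψ g := by
    have := h3 (x₀ - g) (Submodule.mem_sup_right (Submodule.mem_span_singleton_self _))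
    rwa [map_sub, sub_eq_zero] at this
  have hψy : ψ y ≠ ψ g := by rwa [map_sub, sub_ne_zero] at h4
  have hx₀lt : φ x₀ < φ g := (h1 x₀ hx₀).lt_of_ne fun h => hx₀F ((h2 _).2 ⟨hx₀, h⟩)
  have main : ∀ χ : E →ₗ[ℝ] ℝ, (∀ x ∈ V, φ x = φ g → χ x = χ g) → χ x₀ = χ g →
      ∃ t : ℝ, 0 ≤ t ∧ (∀ x ∈ V, χ x + t * φ x ≤ χ g + t * φ g) ∧
        IsFace V (V.filter fun x => χ x + t * φ x = χ g + t * φ g) ∧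
        F ⊂ V.filter fun x => χ x + t * φ x = χ g + t * φ g := by
    intro χ hχ hχ₀
    obtain ⟨t, ht, z, hz, hzlt, hzt⟩ := exists_tilt φ χ h1 ⟨x₀, hx₀, hx₀lt⟩ hχ
    refine ⟨t, ?_, ht, ⟨χ + t • φ, χ g + t * φ g, by simpa using ht, by simp⟩, ?_⟩
    · have := ht x₀ hx₀
      by_contra! h0
      nlinarith
    · rw [Finset.ssubset_iff_of_subset]
      · exact ⟨z, by simp [hz, hzt], fun h => hzlt.ne ((h2 z).1 h).2⟩
      · intro x hx
        have := (h2 x).1 hx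
        simp [this.1, this.2, hχ x this.1 this.2]
  obtain ⟨t, ht0, ht, hA, hFA⟩ := main ψ hψF hψx
  obtain ⟨s, hs0, hs, hB, hFB⟩ := main (-ψ) (fun x hx h => by simp [hψF x hx h]) (by simp [hψx])
  refine ⟨_, _, hA, hB, hFA, hFB, subset_antisymm ?_ (Finset.subset_inter hFA.subset hFB.subset)⟩
  intro x hx
  simp only [Finset.mem_inter, Finset.mem_filter, LinearMap.neg_apply] at hx
  obtain ⟨⟨hxV, hx1⟩, -, hx2⟩ := hx
  have hyt := ht y hy
  have hys := hs y hy
  simp only [LinearMap.neg_apply] at hys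
  have hst : s + t ≠ 0 := by
    intro h0
    have e1 : s = 0 := by linarith
    have e2 : t = 0 := by linarith
    rw [e2] at hyt
    rw [e1] at hys
    exact hψy (by linarith)
  have : (s + t) * (φ x - φ g) = 0 := by linear_combination hx1 + hx2
  rw [mul_eq_zero] at this
  exact (h2 x).2 ⟨hxV, by linarith [this.resolve_left hst]⟩

/-- A point outside a face is missed by a facet through the face. -/
theorem exists_facet (hF : IsFace V F) (hne : F.Nonempty) (hw : w ∈ V) (hwF : w ∉ F) :
    ∃ G ∈ facets V, F ⊆ G ∧ w ∉ G := by
  obtain ⟨H, hH, hmax⟩ := (V.powerset.filter fun H => IsFace V H ∧ F ⊆ H ∧ w ∉ H).exists_max_image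
    Finset.card ⟨F, by simp [hF, hF.subset, hwF]⟩
  simp only [Finset.mem_filter, Finset.mem_powerset] at hH hmax
  obtain ⟨-, hH, hFH, hwH⟩ := hH
  refine ⟨H, mem_facets.2 ⟨hH, ?_⟩, hFH, hwH⟩
  have hlt := dim_lt_of_ssubset hH (hne.mono hFH)
    (hH.subset.ssubset_of_ne (by rintro rfl; exact hwH hw))
  by_contra hd
  obtain ⟨A, B, hA, hB, hHA, hHB, hAB⟩ := exists_two_faces hH (hne.mono hFH) (by omega)
  have : ∀ A, IsFace V A → H ⊂ A → w ∈ A := by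
    intro A hA hHA
    by_contra hwA
    exact absurd (Finset.card_lt_card hHA)
      (not_lt.2 (hmax A ⟨hA.subset, hA, hFH.trans hHA.subset, hwA⟩))
  exact hwH (hAB ▸ Finset.mem_inter.2 ⟨this A hA hHA, this B hB hHB⟩)

theorem le_sup_span_of_finrank_le {W U : Submodule ℝ E} [FiniteDimensional ℝ U] (h : W ≤ U)
    (hd : finrank ℝ U ≤ finrank ℝ W + 1) (hx : x ∈ U) (hxW : x ∉ W) :
    U ≤ W ⊔ Submodule.span ℝ {x} := by
  have hle : W ⊔ Submodule.span ℝ {x} ≤ U := sup_le h (by simpa using hx)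
  have : FiniteDimensional ℝ ↥(W ⊔ Submodule.span ℝ {x}) := Submodule.finiteDimensional_of_le hle
  have hlt : W < W ⊔ Submodule.span ℝ {x} := by
    refine lt_of_le_of_ne le_sup_left fun h => hxW ?_
    rw [h]
    exact Submodule.mem_sup_right (Submodule.mem_span_singleton_self x)
  have := Submodule.finrank_lt_finrank_of_lt hlt
  exact (Submodule.eq_of_le_of_finrank_le hle (by omega)).ge

theorem inter_facets_eq {A B : Finset E} (hR : IsFace V R) (hne : R.Nonempty)
    (hd : dim R + 2 = dim V) (hA : A ∈ facets V) (hB : B ∈ facets V) (hRA : R ⊆ A) (hRB : R ⊆ B)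
    (hAB : A ≠ B) : A ∩ B = R := by
  rw [mem_facets] at hA hB
  have hAB' := hA.1.inter hB.1
  have hss : A ∩ B ⊂ A := Finset.inter_subset_left.ssubset_of_ne fun h => hAB (by
    have : A ⊆ B := Finset.inter_eq_left.1 h
    exact (hA.1.restrict this hB.1.subset).eq_of_dim_le (hne.mono hRA) (by omega))
  have hlt := dim_lt_of_ssubset (hAB'.restrict hss.subset hA.1.subset)
    (hne.mono (Finset.subset_inter hRA hRB)) hss
  exact ((hR.restrict (Finset.subset_inter hRA hRB) hAB'.subset).eq_of_dim_le hne (by omega)).symm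

/-- A ridge lies in at most two facets. -/
theorem facets_through_ridge {A B C : Finset E} (hR : IsFace V R) (hne : R.Nonempty)
    (hd : dim R + 2 = dim V) (hA : A ∈ facets V) (hB : B ∈ facets V) (hC : C ∈ facets V)
    (hRA : R ⊆ A) (hRB : R ⊆ B) (hRC : R ⊆ C) (hAB : A ≠ B) (hCA : C ≠ A) : C = B := by
  by_contra hCB
  have eAB := inter_facets_eq hR hne hd hA hB hRA hRB hAB
  have eCA := inter_facets_eq hR hne hd hC hA hRC hRA hCA
  have eCB := inter_facets_eq hR hne hd hC hB hRC hRB hCB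
  have hpt : ∀ D ∈ facets V, R ⊆ D → ∃ x ∈ D, x ∉ R := by
    intro D hD hRD
    rw [mem_facets] at hD
    by_contra! h
    have : D = R := subset_antisymm h hRD
    rw [this] at hD
    omega
  obtain ⟨a, ha, haR⟩ := hpt A hA hRA
  obtain ⟨b, hb, hbR⟩ := hpt B hB hRB
  obtain ⟨c, hc, hcR⟩ := hpt C hC hRC
  rw [mem_facets] at hA hB hC
  obtain ⟨g, hg⟩ := hne
  have h1 : vectorSpan ℝ (A : Set E) ≤ vectorSpan ℝ (R : Set E) ⊔ Submodule.span ℝ {a - g} := by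
    refine le_sup_span_of_finrank_le (vectorSpan_mono' hRA) ?_ (sub_mem_vectorSpan (hRA hg) ha) ?_
    · have := hA.2
      unfold dim at this hd
      omega
    · intro h
      obtain ⟨φ, e, h1, h2⟩ := hR
      have := eq_of_mem_face h2 h
      rw [map_sub, sub_eq_zero, ((h2 g).1 hg).2] at this
      exact haR ((h2 a).2 ⟨hA.1.subset ha, this⟩)
  have haB : a ∉ B := fun h => haR (eAB ▸ Finset.mem_inter.2 ⟨ha, h⟩)
  have hbA : b ∉ A := fun h => hbR (eAB ▸ Finset.mem_inter.2 ⟨h, hb⟩)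
  have haC : a ∉ C := fun h => haR (eCA ▸ Finset.mem_inter.2 ⟨h, ha⟩)
  have hbC : b ∉ C := fun h => hbR (eCB ▸ Finset.mem_inter.2 ⟨h, hb⟩)
  have hcA : c ∉ A := fun h => hcR (eCA ▸ Finset.mem_inter.2 ⟨hc, h⟩)
  have hcB : c ∉ B := fun h => hcR (eCB ▸ Finset.mem_inter.2 ⟨hc, h⟩)
  have haV := hA.1.subset ha
  have hbV := hB.1.subset hb
  have hcV := hC.1.subset hc
  have hgA := hRA hg
  have hgB := hRB hg
  have hgC := hRC hg
  obtain ⟨⟨α, a', hα, hα'⟩, hdA⟩ := hA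
  obtain ⟨⟨β, b', hβ, hβ'⟩, hdB⟩ := hB
  obtain ⟨⟨γ, c', hγ, hγ'⟩, hdC⟩ := hC
  have hlt : ∀ (χ : E →ₗ[ℝ] ℝ) (e : ℝ) (D : Finset E), (∀ x ∈ V, χ x ≤ e) →
      (∀ x, x ∈ D ↔ x ∈ V ∧ χ x = e) → g ∈ D → ∀ x ∈ V, x ∉ D → χ (x - g) < 0 := by
    intro χ e D h1 h2 h3 x hx hxD
    rw [map_sub, ((h2 g).1 h3).2, sub_neg]
    exact (h1 x hx).lt_of_ne fun h => hxD ((h2 x).2 ⟨hx, h⟩)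
  have h2 : vectorSpan ℝ (V : Set E) ≤ vectorSpan ℝ (A : Set E) ⊔ Submodule.span ℝ {b - g} := by
    have hAV : A ⊆ V := fun x hx => ((hα' x).1 hx).1
    refine le_sup_span_of_finrank_le (vectorSpan_mono' hAV) ?_
      (sub_mem_vectorSpan (hAV hgA) hbV) ?_
    · unfold dim at hdA
      omega
    · exact fun h => (hlt α a' A hα hα' hgA b hbV hbA).ne (eq_of_mem_face hα' h)
  have h3 := (h2.trans (sup_le_sup_right h1 _))
    (sub_mem_vectorSpan ((hα' g).1 hgA).1 hcV)
  rw [Submodule.mem_sup] at h3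
  obtain ⟨z, hz, b₁, hb₁, hcz⟩ := h3
  rw [Submodule.mem_sup] at hz
  obtain ⟨r, hr, a₁, ha₁, hz⟩ := hz
  rw [Submodule.mem_span_singleton] at ha₁ hb₁
  obtain ⟨p, rfl⟩ := ha₁
  obtain ⟨q, rfl⟩ := hb₁
  have hzero : ∀ (χ : E →ₗ[ℝ] ℝ) (e : ℝ) (D : Finset E), (∀ x, x ∈ D ↔ x ∈ V ∧ χ x = e) → R ⊆ D →
      χ (c - g) = p * χ (a - g) + q * χ (b - g) := by
    intro χ e D hχ hRD
    rw [← hcz, ← hz, map_add, map_add, eq_of_mem_face hχ (vectorSpan_mono' hRD hr)]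
    simp
  have hself : ∀ (χ : E →ₗ[ℝ] ℝ) (e : ℝ) (D : Finset E), (∀ x, x ∈ D ↔ x ∈ V ∧ χ x = e) → g ∈ D →
      ∀ x ∈ D, χ (x - g) = 0 := by
    intro χ e D hχ hg x hx
    rw [map_sub, ((hχ g).1 hg).2, ((hχ x).1 hx).2, sub_self]
  have e1 := hzero α a' A hα' hRA
  have e2 := hzero β b' B hβ' hRB
  have e3 := hzero γ c' C hγ' hRC
  rw [hself α a' A hα' hgA a ha] at e1
  rw [hself β b' B hβ' hgB b hb] at e2
  rw [hself γ c' C hγ' hgC c hc] at e3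
  have := hlt α a' A hα hα' hgA b hbV hbA
  have := hlt α a' A hα hα' hgA c hcV hcA
  have := hlt β b' B hβ hβ' hgB a haV haB
  have := hlt β b' B hβ hβ' hgB c hcV hcB
  have := hlt γ c' C hγ hγ' hgC a haV haC
  have := hlt γ c' C hγ hγ' hgC b hbV hbC
  have hq : 0 < q := by
    by_contra! h
    nlinarith
  have hp : 0 < p := by
    by_contra! h
    nlinarith
  nlinarith [mul_pos hp (neg_pos.2 ‹γ (a - g) < 0›), mul_pos hq (neg_pos.2 ‹γ (b - g) < 0›)]

/-- The part of the graph strictly above a hyperplane is connected. -/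
theorem exists_adj_of_partition (hV : ConvPos V) (φ : E →ₗ[ℝ] ℝ) (c : ℝ) {A B : Finset E}
    (hU : ∀ x ∈ V, c < φ x → x ∈ A ∨ x ∈ B) (hA : ∀ x ∈ A, x ∈ V ∧ c < φ x)
    (hB : ∀ x ∈ B, x ∈ V ∧ c < φ x) (hAB : Disjoint A B) (hAne : A.Nonempty) (hBne : B.Nonempty) :
    ∃ a ∈ A, ∃ b ∈ B, b ∈ nb V a := by
  by_contra! hcon
  have top : ∀ C D : Finset E, C.Nonempty → (∀ x ∈ C, x ∈ V ∧ c < φ x) →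
      (∀ x ∈ V, c < φ x → x ∈ C ∨ x ∈ D) → (∀ a ∈ C, ∀ b ∈ D, b ∉ nb V a) →
      ∃ a ∈ C, ∀ u ∈ V, φ u ≤ φ a := by
    intro C D hC hCV hCD hno
    obtain ⟨a, ha, hmax⟩ := C.exists_max_image φ hC
    refine ⟨a, ha, fun u hu => ?_⟩
    by_contra! h
    obtain ⟨w, hw, hlt⟩ := exists_nb_gt hV (hCV a ha).1 φ hu h
    rcases hCD w (nb_subset hw) ((hCV a ha).2.trans hlt) with h | h
    · exact absurd (hmax w h) (not_le.2 hlt)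
    · exact hno a ha w h hw
  obtain ⟨a, ha, hamax⟩ := top A B hAne hA hU hcon
  obtain ⟨b, hb, hbmax⟩ := top B A hBne hB (fun x hx h => (hU x hx h).symm)
    fun b hb a ha h => hcon a ha b hb (mem_nb_comm (hB b hb).1 h)
  have hM : IsFace V (V.filter fun x => φ x = φ a) := ⟨φ, φ a, hamax, by simp⟩
  obtain ⟨ψ, hψ⟩ := IsFace.vertex_functional (hV.of_face hM) (v := a) (by simp [(hA a ha).1])
  obtain ⟨b', hb', hmax⟩ := (B.filter fun x => φ x = φ a).exists_max_image ψ
    ⟨b, by simp [hb, le_antisymm (hamax b (hB b hb).1) (hbmax a (hA a ha).1)]⟩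
  rw [Finset.mem_filter] at hb'
  have hb'M : b' ∈ V.filter fun x => φ x = φ a := by simp [(hB b' hb'.1).1, hb'.2]
  have hba : b' ≠ a := fun h => (Finset.disjoint_left.1 hAB ha) (h ▸ hb'.1)
  obtain ⟨w, hw, hlt⟩ := exists_nb_gt (hV.of_face hM) hb'M ψ (u := a) (by simp [(hA a ha).1])
    (hψ b' hb'M hba)
  rw [nb_face hM hb'M, Finset.mem_inter, Finset.mem_filter] at hw
  rcases hU w hw.2.1 (by rw [hw.2.2]; exact (hA a ha).2) with h | h
  · exact hcon w h b' hb'.1 (mem_nb_comm (hB b' hb'.1).1 hw.1)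
  · exact absurd (hmax w (by simp [h, hw.2.2])) (not_le.2 hlt)

/-- A small vertex set does not separate the graph. -/
theorem exists_adj_of_separator (hV : ConvPos V) {A S B : Finset E} (hVU : V = A ∪ S ∪ B)
    (hAB : Disjoint A B) (hS : S.card + 2 ≤ dim V)
    (hAne : A.Nonempty) (hBne : B.Nonempty) : ∃ a ∈ A, ∃ b ∈ B, b ∈ nb V a := by
  by_contra! hcon
  obtain ⟨a, ha⟩ := hAne
  obtain ⟨b, hb⟩ := hBne
  have haV : a ∈ V := by simp [hVU, ha]
  have hbV : b ∈ V := by simp [hVU, hb]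
  set T : Finset E := insert (b - a) (S.image fun s => s - a) with hT
  obtain ⟨y, hy, hyn⟩ : ∃ y ∈ V, y - a ∉ Submodule.span ℝ (T : Set E) := by
    by_contra! h
    rw [← vectorSpan_le_iff haV] at h
    have h3 := (Submodule.finrank_mono h).trans (finrank_span_finset_le_card T)
    have h4 := (Finset.card_insert_le (b - a) (S.image fun s => s - a)).trans
      (Nat.add_le_add_right Finset.card_image_le 1)
    rw [← hT] at h4
    unfold dim at hS
    omega
  obtain ⟨φ, h1, h2⟩ := exists_dual_of_notMem hyn
  have hφb : φ b = φ a := by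
    have := h1 (b - a) (Submodule.subset_span (by simp [hT]))
    rwa [map_sub, sub_eq_zero] at this
  have hφS : ∀ s ∈ S, φ s = φ a := by
    intro s hs
    have := h1 (s - a) (Submodule.subset_span (by
      rw [hT, Finset.mem_coe]
      exact Finset.mem_insert_of_mem (Finset.mem_image_of_mem _ hs)))
    rwa [map_sub, sub_eq_zero] at this
  rw [map_sub, sub_ne_zero] at h2
  have main : ∀ χ : E →ₗ[ℝ] ℝ, χ b = χ a → (∀ s ∈ S, χ s = χ a) → χ a < χ y → False := by
    intro χ hb' hS' hy'
    obtain ⟨u, hu, hua⟩ := exists_nb_gt hV haV χ hy hy'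
    obtain ⟨w, hw, hwb⟩ := exists_nb_gt hV hbV χ hy (hb' ▸ hy')
    have hmem : ∀ x ∈ V, χ a < χ x → x ∈ A ∨ x ∈ B := by
      intro x hx hlt
      rw [hVU, Finset.mem_union, Finset.mem_union] at hx
      rcases hx with (h | h) | h
      · exact Or.inl h
      · exact absurd (hS' x h) hlt.ne'
      · exact Or.inr h
    have huA : u ∈ A := (hmem u (nb_subset hu) hua).resolve_right fun h => hcon a ha u h hu
    have hwB : w ∈ B := (hmem w (nb_subset hw) (hb' ▸ hwb)).resolve_left fun h =>
      hcon w h b hb (mem_nb_comm hbV hw)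
    obtain ⟨p, hp, q, hq, hpq⟩ := exists_adj_of_partition hV χ (χ a)
      (A := A.filter fun x => χ a < χ x) (B := B.filter fun x => χ a < χ x)
      (fun x hx h => by simpa [h] using hmem x hx h)
      (fun x hx => by
        rw [Finset.mem_filter] at hx
        exact ⟨by simp [hVU, hx.1], hx.2⟩)
      (fun x hx => by
        rw [Finset.mem_filter] at hx
        exact ⟨by simp [hVU, hx.1], hx.2⟩)
      (Finset.disjoint_filter_filter hAB) ⟨u, by simp [huA, hua]⟩ ⟨w, by simp [hwB, hb' ▸ hwb]⟩
    exact hcon p (Finset.mem_filter.1 hp).1 q (Finset.mem_filter.1 hq).1 hpq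
  rcases lt_or_gt_of_ne h2 with h | h
  · exact main (-φ) (by simp [hφb]) (fun s hs => by simp [hφS s hs]) (by simpa using h)
  · exact main φ hφb hφS h

theorem exists_nb_notMem_facet (hV : ConvPos V) (hF : IsFace V F) (hx : x ∈ V) (hxF : x ∉ F)
    (hw : w ∈ V) (hwF : w ∉ F) (hwx : w ≠ x) : ∃ y ∈ nb V x, y ∉ F := by
  obtain ⟨φ, c, h1, h2⟩ := hF
  have hlt : ∀ z ∈ V, z ∉ F → φ z < c := fun z hz hzF =>
    (h1 z hz).lt_of_ne fun h => hzF ((h2 z).2 ⟨hz, h⟩)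
  obtain ⟨a, ha, b, hb, hab⟩ := exists_adj_of_partition hV (-φ) (-c) (A := {x})
    (B := (V \ F).erase x)
    (fun z hz hzc => by
      have : z ∉ F := fun h => by
        have := ((h2 z).1 h).2
        simp [this] at hzc
      by_cases hzx : z = x <;> simp [hzx, hz, this])
    (by simpa [hx] using hlt x hx hxF)
    (fun z hz => by
      simp only [Finset.mem_erase, Finset.mem_sdiff] at hz
      exact ⟨hz.2.1, by simpa using hlt z hz.2.1 hz.2.2⟩)
    (by simp) (by simp) ⟨w, by simp [hw, hwF, hwx]⟩
  rw [Finset.mem_singleton] at ha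
  subst ha
  simp only [Finset.mem_erase, Finset.mem_sdiff] at hb
  exact ⟨b, hab, hb.2.2⟩

end Geometry

section Combinatorics

variable {E : Type*} [AddCommGroup E] [Module ℝ E] {V F G H R : Finset E} {v w x : E}

/-- Every vertex has the least possible number of neighbours. -/
def Simple (V : Finset E) : Prop := ∀ v ∈ V, (nb V v).card = dim V

theorem card_nb_face_add (hF : IsFace V F) (hv : v ∈ F) :
    (nb F v).card + (nb V v \ F).card = (nb V v).card := by
  rw [nb_face hF hv, Finset.card_inter_add_card_sdiff]

theorem card_nb_lt (hv : v ∈ V) : (nb V v).card < V.card :=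
  Finset.card_lt_card ⟨nb_subset, fun h => notMem_nb_self (h hv)⟩

theorem dim_lt_card (hV : ConvPos V) (hne : V.Nonempty) : dim V < V.card := by
  obtain ⟨v, hv⟩ := hne
  exact (dim_le_card_nb hV hv).trans_lt (card_nb_lt hv)

theorem nonempty_of_dim_pos (h : 0 < dim V) : V.Nonempty := by
  rw [Finset.nonempty_iff_ne_empty]
  rintro rfl
  rw [dim, Finset.coe_empty, vectorSpan_empty, finrank_bot] at h
  exact h.false

theorem facet_isFace (hF : F ∈ facets V) : IsFace V F := (mem_facets.1 hF).1

theorem facet_dim (hF : F ∈ facets V) : dim F + 1 = dim V := (mem_facets.1 hF).2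

theorem facet_nonempty (hd : 2 ≤ dim V) (hF : F ∈ facets V) : F.Nonempty :=
  nonempty_of_dim_pos (by have := facet_dim hF; omega)

theorem facet_eq_of_subset (hF : F ∈ facets V) (hG : G ∈ facets V) (hne : F.Nonempty)
    (h : F ⊆ G) : F = G :=
  ((facet_isFace hF).restrict h (facet_isFace hG).subset).eq_of_dim_le hne
    (by have := facet_dim hF; have := facet_dim hG; omega)

theorem exists_notMem_facet (hF : F ∈ facets V) : ∃ x ∈ V, x ∉ F := by
  by_contra! h
  have h1 := facet_dim hF
  have h2 := dim_mono (F := V) (V := F) h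
  omega

theorem dim_inter_add_two_le (hF : F ∈ facets V) (hG : G ∈ facets V) (hFG : F ≠ G)
    (hne : (F ∩ G).Nonempty) : dim (F ∩ G) + 2 ≤ dim V := by
  have h1 := (facet_isFace hF).inter (facet_isFace hG)
  have h2 : F ∩ G ⊂ F := Finset.inter_subset_left.ssubset_of_ne fun h =>
    hFG (facet_eq_of_subset hF hG (hne.mono Finset.inter_subset_left) (Finset.inter_eq_left.1 h))
  have h3 := dim_lt_of_ssubset (h1.restrict h2.subset (facet_isFace hF).subset) hne h2
  have := facet_dim hF
  omega

theorem one_le_card_nb_sdiff (hV : ConvPos V) (hF : F ∈ facets V) (hv : v ∈ F) :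
    1 ≤ (nb V v \ F).card := by
  have := dim_le_dim_add_card hV (facet_isFace hF) hv
  have := facet_dim hF
  omega

theorem card_nb_face_of_simple (hV : ConvPos V) (hs : (nb V v).card = dim V) (hF : IsFace V F)
    (hv : v ∈ F) : (nb F v).card = dim F := by
  have h1 := dim_le_dim_add_card hV hF hv
  have h2 := dim_le_card_nb (hV.of_face hF) hv
  have h3 := card_nb_face_add hF hv
  omega

theorem Simple.face (hV : ConvPos V) (hs : Simple V) (hF : IsFace V F) : Simple F := fun v hv =>
  card_nb_face_of_simple hV (hs v (hF.subset hv)) hF hv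

theorem card_nb_sdiff_of_simple (hV : ConvPos V) (hs : (nb V v).card = dim V) (hF : F ∈ facets V)
    (hv : v ∈ F) : (nb V v \ F).card = 1 := by
  have h1 := card_nb_face_of_simple hV hs (facet_isFace hF) hv
  have h2 := card_nb_face_add (facet_isFace hF) hv
  have := facet_dim hF
  omega

theorem card_nb_sdiff_inter_le (F G : Finset E) :
    (nb V v \ (F ∩ G)).card ≤ (nb V v \ F).card + (nb V v \ G).card := by
  rw [Finset.sdiff_inter_distrib_right]
  exact Finset.card_union_le _ _

theorem dim_inter_of_card_sdiff (hV : ConvPos V) (hF : F ∈ facets V) (hG : G ∈ facets V)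
    (hFG : F ≠ G) (hvF : v ∈ F) (hvG : v ∈ G) (h1 : (nb V v \ F).card = 1)
    (h2 : (nb V v \ G).card = 1) : dim (F ∩ G) + 2 = dim V := by
  have hv : v ∈ F ∩ G := Finset.mem_inter.2 ⟨hvF, hvG⟩
  have h3 := dim_inter_add_two_le hF hG hFG ⟨v, hv⟩
  have h4 := dim_le_dim_add_card hV ((facet_isFace hF).inter (facet_isFace hG)) hv
  have h5 := card_nb_sdiff_inter_le (V := V) (v := v) F G
  omega

theorem facet_unique_of_card_sdiff (hV : ConvPos V) (hF : F ∈ facets V) (hG : G ∈ facets V)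
    (hvF : v ∈ F) (hvG : v ∈ G) (h1 : (nb V v \ F).card = 1)
    (h2 : (nb V v \ G).card = 1) (hw : w ∈ nb V v) (hwF : w ∉ F) (hwG : w ∉ G) : F = G := by
  by_contra hFG
  have hv : v ∈ F ∩ G := Finset.mem_inter.2 ⟨hvF, hvG⟩
  have h3 := dim_inter_add_two_le hF hG hFG ⟨v, hv⟩
  have h4 := dim_le_dim_add_card hV ((facet_isFace hF).inter (facet_isFace hG)) hv
  have h5 := Finset.card_union_add_card_inter (nb V v \ F) (nb V v \ G)
  have h6 : 1 ≤ ((nb V v \ F) ∩ (nb V v \ G)).card :=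
    Finset.card_pos.2 ⟨w, by simp [hw, hwF, hwG]⟩
  rw [← Finset.sdiff_inter_distrib_right] at h5
  omega

theorem facet_unique (hV : ConvPos V) (hs : (nb V v).card = dim V) (hF : F ∈ facets V)
    (hG : G ∈ facets V) (hvF : v ∈ F) (hvG : v ∈ G) (hw : w ∈ nb V v) (hwF : w ∉ F)
    (hwG : w ∉ G) : F = G :=
  facet_unique_of_card_sdiff hV hF hG hvF hvG (card_nb_sdiff_of_simple hV hs hF hvF)
    (card_nb_sdiff_of_simple hV hs hG hvG) hw hwF hwG

theorem eq_of_mem_nb_sdiff {y : E} (h : (nb V v \ F).card = 1) (hx : x ∈ nb V v) (hxF : x ∉ F)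
    (hy : y ∈ nb V v) (hyF : y ∉ F) : x = y :=
  Finset.card_le_one.1 h.le x (by simp [hx, hxF]) y (by simp [hy, hyF])

theorem exists_facet_of_nb (hV : ConvPos V) (hv : v ∈ V) (hw : w ∈ nb V v) :
    ∃ G ∈ facets V, v ∈ G ∧ w ∉ G := by
  obtain ⟨G, hG, h1, h2⟩ := exists_facet (hV v hv) (by simp) (nb_subset hw)
    (by simpa using (mem_nb.1 hw).2.1)
  exact ⟨G, hG, by simpa using h1, h2⟩

theorem card_facets_at (hV : ConvPos V) (hv : v ∈ V) (hs : (nb V v).card = dim V) :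
    ((facets V).filter fun F => v ∈ F).card = dim V := by
  rw [← hs]
  choose! f h1 h2 h3 using fun w (hw : w ∈ nb V v) => exists_facet_of_nb hV hv hw
  symm
  refine Finset.card_bij (fun w _ => f w) (fun w hw => by simp [h1 w hw, h2 w hw]) ?_ ?_
  · intro w hw u hu hwu
    refine eq_of_mem_nb_sdiff (card_nb_sdiff_of_simple hV hs (h1 w hw) (h2 w hw)) hw (h3 w hw) hu ?_
    rw [hwu]
    exact h3 u hu
  · intro F hF
    rw [Finset.mem_filter] at hF
    obtain ⟨w, hw⟩ := Finset.card_pos.1 (one_le_card_nb_sdiff hV hF.1 hF.2)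
    rw [Finset.mem_sdiff] at hw
    exact ⟨w, hw.1, facet_unique hV hs (h1 w hw.1) hF.1 (h2 w hw.1) hF.2 hw.1 (h3 w hw.1) hw.2⟩

theorem sum_card_facets (hV : ConvPos V) (hs : Simple V) :
    ∑ F ∈ facets V, F.card = dim V * V.card := by
  have h1 : ∀ F ∈ facets V, F.card = ∑ v ∈ V, if v ∈ F then 1 else 0 := by
    intro F hF
    rw [← Finset.sum_filter, Finset.filter_mem_eq_inter,
      Finset.inter_eq_right.2 (facet_isFace hF).subset, Finset.card_eq_sum_ones]
  rw [Finset.sum_congr rfl h1, Finset.sum_comm, mul_comm]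
  refine Finset.sum_const_nat fun v hv => ?_
  rw [← Finset.sum_filter, ← Finset.card_eq_sum_ones, card_facets_at hV hv (hs v hv)]

/-- The other facet through a ridge. -/
theorem exists_other_facet (hF : F ∈ facets V) (hR : R ∈ facets F) (hne : R.Nonempty) :
    ∃ G ∈ facets V, G ≠ F ∧ F ∩ G = R := by
  obtain ⟨x, hx, hxR⟩ := exists_notMem_facet hR
  have hRV := (facet_isFace hF).trans (facet_isFace hR)
  obtain ⟨G, hG, hRG, hxG⟩ := exists_facet hRV hne ((facet_isFace hF).subset hx) hxR
  have hGF : G ≠ F := by rintro rfl; exact hxG hx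
  refine ⟨G, hG, hGF, inter_facets_eq hRV hne ?_ hF hG (facet_isFace hR).subset hRG hGF.symm⟩
  have := facet_dim hF
  have := facet_dim hR
  omega

theorem card_facets_facet_le (hd : 3 ≤ dim V) (hF : F ∈ facets V) :
    (facets F).card ≤ ((facets V).filter fun G => G ≠ F ∧ (F ∩ G).Nonempty).card := by
  have h0 := facet_dim hF
  have hne : ∀ R ∈ facets F, R.Nonempty := fun R hR => facet_nonempty (by omega) hR
  choose! f h1 h2 h3 using fun R (hR : R ∈ facets F) => exists_other_facet hF hR (hne R hR)
  refine Finset.card_le_card_of_injOn f (fun R hR => ?_) fun R hR S hS hRS => ?_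
  · rw [Finset.mem_coe, Finset.mem_filter, h3 R hR]
    exact ⟨h1 R hR, h2 R hR, hne R hR⟩
  · rw [← h3 R hR, ← h3 S hS, hRS]

theorem inter_mem_facets (hF : F ∈ facets V) (hG : G ∈ facets V)
    (h : dim (F ∩ G) + 2 = dim V) : F ∩ G ∈ facets F := by
  refine mem_facets.2 ⟨((facet_isFace hF).inter (facet_isFace hG)).restrict
    Finset.inter_subset_left (facet_isFace hF).subset, ?_⟩
  have := facet_dim hF
  omega

theorem Simple.dim_inter (hV : ConvPos V) (hs : Simple V) (hF : F ∈ facets V) (hG : G ∈ facets V)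
    (hFG : F ≠ G) (hne : (F ∩ G).Nonempty) : dim (F ∩ G) + 2 = dim V := by
  obtain ⟨v, hv⟩ := hne
  rw [Finset.mem_inter] at hv
  have hvs := hs v ((facet_isFace hF).subset hv.1)
  exact dim_inter_of_card_sdiff hV hF hG hFG hv.1 hv.2 (card_nb_sdiff_of_simple hV hvs hF hv.1)
    (card_nb_sdiff_of_simple hV hvs hG hv.2)

theorem card_filter_le_card_facets (hV : ConvPos V) (hs : Simple V) (hF : F ∈ facets V) :
    ((facets V).filter fun G => G ≠ F ∧ (F ∩ G).Nonempty).card ≤ (facets F).card := by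
  refine Finset.card_le_card_of_injOn (fun G => F ∩ G) (fun G hG => ?_) fun G hG H hH hGH => ?_
  · rw [Finset.mem_coe, Finset.mem_filter] at hG
    exact inter_mem_facets hF hG.1 (hs.dim_inter hV hF hG.1 hG.2.1.symm hG.2.2)
  · rw [Finset.mem_coe, Finset.mem_filter] at hG hH
    refine facets_through_ridge ((facet_isFace hF).inter (facet_isFace hG.1)) hG.2.2
      (hs.dim_inter hV hF hG.1 hG.2.1.symm hG.2.2) hF hH.1 hG.1 Finset.inter_subset_left ?_
      Finset.inter_subset_right hH.2.1.symm hG.2.1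
    simp only at hGH
    rw [hGH]
    exact Finset.inter_subset_right

theorem card_facets_lt (hd : 3 ≤ dim V) (hF : F ∈ facets V) :
    (facets F).card < (facets V).card := by
  refine (card_facets_facet_le hd hF).trans_lt (Finset.card_lt_card ⟨Finset.filter_subset _ _, ?_⟩)
  intro h
  exact (Finset.mem_filter.1 (h hF)).2.1 rfl

/-- The number of facets disjoint from a given one. -/
theorem card_facets_le_add_disjoint (hV : ConvPos V) (hs : Simple V) (hF : F ∈ facets V) :
    (facets V).card ≤ 1 + (facets F).card + ((facets V).filter fun G => Disjoint F G).card := by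
  have h : facets V ⊆ {F} ∪ ((facets V).filter fun G => G ≠ F ∧ (F ∩ G).Nonempty) ∪
      ((facets V).filter fun G => Disjoint F G) := by
    intro G hG
    by_cases h1 : G = F
    · simp [h1]
    · by_cases h2 : Disjoint F G
      · simp [hG, h2]
      · have : (F ∩ G).Nonempty := Finset.not_disjoint_iff_nonempty_inter.1 h2
        simp [hG, h1, this]
  refine (Finset.card_le_card h).trans ((Finset.card_union_le _ _).trans ?_)
  refine Nat.add_le_add_right ((Finset.card_union_le _ _).trans ?_) _
  rw [Finset.card_singleton]
  exact Nat.add_le_add_left (card_filter_le_card_facets hV hs hF) _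

theorem sum_card_nb_inter_comm {A B : Finset E} (hA : A ⊆ V) (hB : B ⊆ V) :
    ∑ a ∈ A, (nb V a ∩ B).card = ∑ b ∈ B, (nb V b ∩ A).card := by
  have h : ∀ (B : Finset E) (a : E), (nb V a ∩ B).card = ∑ b ∈ B, if b ∈ nb V a then 1 else 0 := by
    intro B a
    rw [← Finset.sum_filter, ← Finset.card_eq_sum_ones, Finset.filter_mem_eq_inter,
      Finset.inter_comm]
  simp only [h]
  rw [Finset.sum_comm]
  refine Finset.sum_congr rfl fun b hb => Finset.sum_congr rfl fun a ha => ?_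
  congr 1
  exact propext ⟨mem_nb_comm (hA ha), mem_nb_comm (hB hb)⟩

theorem sum_card_nb_eq :
    ∑ v ∈ V, (nb V v).card = 2 * ((V.powersetCard 2).filter fun e => IsFace V e).card := by
  set S := (V.powersetCard 2).filter fun e => IsFace V e with hS
  have h1 : ∀ v ∈ V, (nb V v).card = ∑ e ∈ S, if v ∈ e then 1 else 0 := by
    intro v hv
    rw [← Finset.sum_filter, ← Finset.card_eq_sum_ones]
    refine Finset.card_bij (fun w _ => {v, w}) (fun w hw => ?_) (fun w hw u hu h => ?_)
      fun e he => ?_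
    · rw [mem_nb] at hw
      simp only [hS, Finset.mem_filter, Finset.mem_powersetCard]
      refine ⟨⟨⟨?_, Finset.card_pair hw.2.1.symm⟩, hw.2.2⟩, by simp⟩
      simp [Finset.insert_subset_iff, hv, hw.1]
    · have : w ∈ ({v, u} : Finset E) := by rw [← h]; simp
      rw [Finset.mem_insert, Finset.mem_singleton] at this
      exact this.resolve_left (mem_nb.1 hw).2.1
    · simp only [hS, Finset.mem_filter, Finset.mem_powersetCard] at he
      obtain ⟨⟨⟨he1, he2⟩, he3⟩, he4⟩ := he
      obtain ⟨a, b, hab, rfl⟩ := Finset.card_eq_two.1 he2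
      rw [Finset.mem_insert, Finset.mem_singleton] at he4
      rcases he4 with rfl | rfl
      · exact ⟨b, mem_nb.2 ⟨he1 (by simp), hab.symm, he3⟩, rfl⟩
      · exact ⟨a, mem_nb.2 ⟨he1 (by simp), hab, by rwa [Finset.pair_comm]⟩, Finset.pair_comm _ _⟩
  rw [Finset.sum_congr rfl h1, Finset.sum_comm, mul_comm]
  refine Finset.sum_const_nat fun e he => ?_
  simp only [hS, Finset.mem_filter, Finset.mem_powersetCard] at he
  rw [← Finset.sum_filter, ← Finset.card_eq_sum_ones, Finset.filter_mem_eq_inter,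
    Finset.inter_eq_right.2 he.1.1, he.1.2]

theorem Simple.even_card (hs : Simple V) (hd : dim V = 5) : Even V.card := by
  have h := sum_card_nb_eq (V := V)
  rw [Finset.sum_congr rfl hs, Finset.sum_const, smul_eq_mul, hd] at h
  exact ⟨((V.powersetCard 2).filter fun e => IsFace V e).card - 2 * V.card, by omega⟩

theorem card_nb_inter_le {A : Finset E} (hx : x ∈ A) : (nb V x ∩ A).card + 1 ≤ A.card := by
  refine Finset.card_lt_card ⟨Finset.inter_subset_right, fun h => ?_⟩
  exact notMem_nb_self (Finset.mem_inter.1 (h hx)).1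

/-- Counting edges between a facet and its complement. -/
theorem Simple.card_add_sum (hV : ConvPos V) (hs : Simple V) (hF : F ∈ facets V) :
    F.card + ∑ x ∈ V \ F, (nb V x ∩ (V \ F)).card = dim V * (V \ F).card := by
  have hFV := (facet_isFace hF).subset
  have h1 : ∑ x ∈ V \ F, (nb V x).card = dim V * (V \ F).card := by
    rw [mul_comm]
    exact Finset.sum_const_nat fun x hx => hs x (Finset.mem_sdiff.1 hx).1
  have h2 : ∑ x ∈ V \ F, (nb V x ∩ F).card = F.card := by
    rw [sum_card_nb_inter_comm Finset.sdiff_subset hFV, Finset.card_eq_sum_ones]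
    refine Finset.sum_congr rfl fun f hf => ?_
    rw [← card_nb_sdiff_of_simple hV (hs f (hFV hf)) hF hf]
    congr 1
    ext y
    simp only [Finset.mem_inter, Finset.mem_sdiff]
    exact ⟨fun h => ⟨h.1, h.2.2⟩, fun h => ⟨h.1, nb_subset h.1, h.2⟩⟩
  rw [← h1, ← h2, ← Finset.sum_add_distrib]
  refine Finset.sum_congr rfl fun x hx => ?_
  rw [← Finset.card_inter_add_card_sdiff (nb V x) F]
  congr 2
  ext y
  simp only [Finset.mem_inter, Finset.mem_sdiff]
  exact ⟨fun h => ⟨h.1, h.2.2⟩, fun h => ⟨h.1, nb_subset h.1, h.2⟩⟩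

theorem one_le_card_nb_inter (hV : ConvPos V) (hF : IsFace V F) (h : 2 ≤ (V \ F).card)
    (hx : x ∈ V \ F) : 1 ≤ (nb V x ∩ (V \ F)).card := by
  obtain ⟨w, hw, hwx⟩ := Finset.exists_mem_ne (by omega : 1 < (V \ F).card) x
  rw [Finset.mem_sdiff] at hx hw
  obtain ⟨y, hy, hyF⟩ := exists_nb_notMem_facet hV hF hx.1 hx.2 hw.1 hw.2 hwx
  exact Finset.card_pos.2 ⟨y, by simp [hy, hyF, nb_subset hy]⟩

theorem Simple.exists_count (hV : ConvPos V) (hs : Simple V) (hF : F ∈ facets V) :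
    ∃ s D, F.card + s = V.card ∧ 1 ≤ s ∧ (V \ F).card = s ∧
      ∑ x ∈ V \ F, (nb V x ∩ (V \ F)).card = D ∧
      F.card + D = dim V * s ∧ D ≤ s * (s - 1) ∧ (2 ≤ s → s ≤ D) := by
  have hFV := (facet_isFace hF).subset
  refine ⟨(V \ F).card, _, ?_, ?_, rfl, rfl, hs.card_add_sum hV hF, ?_, fun h => ?_⟩
  · rw [add_comm]
    exact Finset.card_sdiff_add_card_eq_card hFV
  · obtain ⟨x, hx, hxF⟩ := exists_notMem_facet hF
    exact Finset.card_pos.2 ⟨x, by simp [hx, hxF]⟩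
  · rw [← smul_eq_mul]
    exact Finset.sum_le_card_nsmul _ _ _ fun x hx => Nat.le_sub_one_of_lt (card_nb_inter_le hx)
  · calc (V \ F).card = ∑ x ∈ V \ F, 1 := Finset.card_eq_sum_ones _
      _ ≤ _ := Finset.sum_le_sum fun x hx => one_le_card_nb_inter hV (facet_isFace hF) h hx

theorem le_card_facet (hV : ConvPos V) (hd : 2 ≤ dim V) (hF : F ∈ facets V) : dim V ≤ F.card := by
  have := dim_lt_card (hV.of_face (facet_isFace hF)) (facet_nonempty hd hF)
  have := facet_dim hF
  omega

theorem exists_mem_facets (hV : ConvPos V) (hd : 1 ≤ dim V) : ∃ F, F ∈ facets V := by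
  obtain ⟨v, hv⟩ := nonempty_of_dim_pos hd
  obtain ⟨w, hw⟩ := Finset.card_pos.1 (hd.trans (dim_le_card_nb hV hv))
  obtain ⟨G, hG, -⟩ := exists_facet_of_nb hV hv hw
  exact ⟨G, hG⟩

/-- Two intersecting simplex facets. -/
theorem Simple.card_of_simplex_facets (hV : ConvPos V) (hs : Simple V) (hd : 4 ≤ dim V)
    (hF : F ∈ facets V) (hG : G ∈ facets V) (hFG : F ≠ G) (hne : (F ∩ G).Nonempty)
    (hFc : F.card = dim V) (hGc : G.card = dim V) : V.card = dim V + 1 := by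
  have hFf := facet_isFace hF
  have hGf := facet_isFace hG
  have hdim := hs.dim_inter hV hF hG hFG hne
  have hR := dim_lt_card (hV.of_face (hFf.inter hGf)) hne
  have hR' : (F ∩ G).card < F.card := Finset.card_lt_card
    ⟨Finset.inter_subset_left, fun h => hFG (facet_eq_of_subset hF hG
      (hne.mono Finset.inter_subset_left) (Finset.subset_inter_iff.1 h).2)⟩
  have hFs := Finset.card_sdiff_add_card_inter F G
  have hGs := Finset.card_sdiff_add_card_inter G F
  rw [Finset.inter_comm G F] at hGs
  have hU : V = F ∪ G := by
    by_contra hU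
    have hss : F ∪ G ⊂ V := (Finset.union_subset hFf.subset hGf.subset).ssubset_of_ne (Ne.symm hU)
    obtain ⟨y, hy, hyn⟩ := Finset.exists_of_ssubset hss
    obtain ⟨a, ha, b, hb, hab⟩ := exists_adj_of_separator hV (A := F ∩ G)
      (S := (F \ G) ∪ (G \ F)) (B := V \ (F ∪ G))
      (by
        ext z
        have h1 : z ∈ F → z ∈ V := fun h => hFf.subset h
        have h2 : z ∈ G → z ∈ V := fun h => hGf.subset h
        simp only [Finset.mem_union, Finset.mem_inter, Finset.mem_sdiff]
        tauto)
      (Finset.disjoint_left.2 fun z hz => by simp [(Finset.mem_inter.1 hz).1])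
      (by
        have := Finset.card_union_le (F \ G) (G \ F)
        omega)
      hne ⟨y, by simp [hy] at hyn ⊢; exact hyn⟩
    rw [Finset.mem_inter] at ha
    rw [Finset.mem_sdiff, Finset.mem_union, not_or] at hb
    have hsa := hs a (hFf.subset ha.1)
    have key : nb F a = F.erase a := by
      refine Finset.eq_of_subset_of_card_le (fun z hz => ?_) ?_
      · exact Finset.mem_erase.2 ⟨(mem_nb.1 hz).2.1, nb_subset hz⟩
      · rw [Finset.card_erase_of_mem ha.1, card_nb_face_of_simple hV hsa hFf ha.1]
        have := facet_dim hF
        omega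
    obtain ⟨g, hg⟩ := Finset.card_pos.1 (by omega : 0 < (G \ F).card)
    rw [Finset.mem_sdiff] at hg
    have key' : nb G a = G.erase a := by
      refine Finset.eq_of_subset_of_card_le (fun z hz => ?_) ?_
      · exact Finset.mem_erase.2 ⟨(mem_nb.1 hz).2.1, nb_subset hz⟩
      · rw [Finset.card_erase_of_mem ha.2, card_nb_face_of_simple hV hsa hGf ha.2]
        have := facet_dim hG
        omega
    have hga : g ∈ nb V a := by
      have : g ∈ nb G a := by
        rw [key', Finset.mem_erase]
        exact ⟨by rintro rfl; exact hg.2 ha.1, hg.1⟩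
      rw [nb_face hGf ha.2, Finset.mem_inter] at this
      exact this.1
    have := eq_of_mem_nb_sdiff (card_nb_sdiff_of_simple hV hsa hF ha.1) hab hb.2.1 hga hg.2
    exact hb.2.2 (this ▸ hg.1)
  have := Finset.card_union_add_card_inter F G
  rw [← hU] at this
  omega

theorem Simple.card_of_forall_simplex (hV : ConvPos V) (hs : Simple V) (hd : 4 ≤ dim V)
    (h : ∀ F ∈ facets V, F.card = dim V) : V.card = dim V + 1 := by
  obtain ⟨F, hF⟩ := exists_mem_facets hV (by omega)
  have hFd := facet_dim hF
  obtain ⟨R, hR⟩ := exists_mem_facets (hV.of_face (facet_isFace hF)) (by omega)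
  have hne := facet_nonempty (by omega) hR
  obtain ⟨G, hG, hGF, hFG⟩ := exists_other_facet hF hR hne
  exact hs.card_of_simplex_facets hV hd hF hG hGF.symm (by rwa [hFG]) (h F hF) (h G hG)

end Combinatorics

section SimplePolytopes

variable {E : Type*} [AddCommGroup E] [Module ℝ E] {V F G H R : Finset E} {v w x : E}

theorem Simple.four_card_ne (hV : ConvPos V) (hs : Simple V) (hd : dim V = 4) :
    V.card ≠ 6 ∧ V.card ≠ 7 := by
  obtain ⟨F, hF⟩ := exists_mem_facets hV (by omega)
  obtain ⟨s, D, h1, h2, -, -, h3, h4, h5⟩ := hs.exists_count hV hF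
  have h6 := le_card_facet hV (by omega) hF
  rw [hd] at h3 h6
  by_contra! h
  have : s = 1 ∨ s = 2 ∨ s = 3 := by omega
  rcases this with rfl | rfl | rfl <;> omega

theorem Simple.five_card (hV : ConvPos V) (hs : Simple V) (hd : dim V = 5) :
    Even V.card ∧ 6 ≤ V.card ∧ V.card ≠ 8 := by
  obtain ⟨F, hF⟩ := exists_mem_facets hV (by omega)
  obtain ⟨s, D, h1, h2, -, -, h3, h4, h5⟩ := hs.exists_count hV hF
  have h6 := le_card_facet hV (by omega) hF
  rw [hd] at h3 h6
  refine ⟨hs.even_card hd, by omega, fun h => ?_⟩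
  have : s = 1 ∨ s = 2 ∨ s = 3 := by omega
  rcases this with rfl | rfl | rfl <;> omega

theorem card_of_dim_one (hV : ConvPos V) (hd : dim V = 1) : V.card = 2 := by
  obtain ⟨v, hv⟩ := nonempty_of_dim_pos (by omega : 0 < dim V)
  obtain ⟨w, hw⟩ := Finset.card_pos.1 ((by omega : 0 < dim V).trans_le (dim_le_card_nb hV hv))
  rw [mem_nb] at hw
  have h1 : IsFace {v, w} {v} := (hV v hv).restrict (by simp) (by
    simp [Finset.insert_subset_iff, hv, hw.1])
  have h2 := dim_lt_of_ssubset h1 (by simp) ⟨by simp, fun h => hw.2.1 (by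
    simpa using h (by simp : w ∈ ({v, w} : Finset E)))⟩
  rw [← hw.2.2.eq_of_dim_le (by simp) (by omega), Finset.card_pair hw.2.1.symm]

theorem Simple.mul_card_le (hV : ConvPos V) (hs : Simple V) {b : ℕ}
    (hb : ∀ F ∈ facets V, F.card ≤ b) : dim V * V.card ≤ (facets V).card * b := by
  rw [← sum_card_facets hV hs, ← smul_eq_mul]
  exact Finset.sum_le_card_nsmul _ _ _ hb

theorem Simple.two_card_le (hV : ConvPos V) (hs : Simple V) (hd : dim V = 2)
    (hn : (facets V).card ≤ 4) : V.card ≤ 4 := by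
  have := hs.mul_card_le hV (b := 2) fun F hF =>
    (card_of_dim_one (hV.of_face (facet_isFace hF)) (by have := facet_dim hF; omega)).le
  rw [hd] at this
  omega

theorem Simple.three_card_le (hV : ConvPos V) (hs : Simple V) (hd : dim V = 3)
    (hn : (facets V).card ≤ 5) : V.card ≤ 6 := by
  have := hs.mul_card_le hV (b := 4) fun F hF =>
    (hs.face hV (facet_isFace hF)).two_card_le (hV.of_face (facet_isFace hF))
      (by have := facet_dim hF; omega) (by have := card_facets_lt (by omega) hF; omega)
  rw [hd] at this
  omega

theorem Simple.four_card_le (hV : ConvPos V) (hs : Simple V) (hd : dim V = 4)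
    (hn : (facets V).card ≤ 6) : V.card ≤ 9 := by
  have := hs.mul_card_le hV (b := 6) fun F hF =>
    (hs.face hV (facet_isFace hF)).three_card_le (hV.of_face (facet_isFace hF))
      (by have := facet_dim hF; omega) (by have := card_facets_lt (by omega) hF; omega)
  rw [hd] at this
  omega

theorem Simple.five_card_le (hV : ConvPos V) (hs : Simple V) (hd : dim V = 5)
    (hn : (facets V).card ≤ 7) : V.card ≤ 12 := by
  have := hs.mul_card_le hV (b := 9) fun F hF =>
    (hs.face hV (facet_isFace hF)).four_card_le (hV.of_face (facet_isFace hF))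
      (by have := facet_dim hF; omega) (by have := card_facets_lt (by omega) hF; omega)
  rw [hd] at this
  omega

theorem Simple.six_card_le (hV : ConvPos V) (hs : Simple V) (hd : dim V = 6)
    (hn : (facets V).card ≤ 8) : V.card ≤ 16 := by
  have := hs.mul_card_le hV (b := 12) fun F hF =>
    (hs.face hV (facet_isFace hF)).five_card_le (hV.of_face (facet_isFace hF))
      (by have := facet_dim hF; omega) (by have := card_facets_lt (by omega) hF; omega)
  rw [hd] at this
  omega

theorem Simple.facet_of_six (hV : ConvPos V) (hs : Simple V) (hd : dim V = 6) (hF : F ∈ facets V) :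
    Even F.card ∧ 6 ≤ F.card ∧ F.card ≠ 8 :=
  (hs.face hV (facet_isFace hF)).five_card (hV.of_face (facet_isFace hF))
    (by have := facet_dim hF; omega)

theorem Simple.six_card_ne (hV : ConvPos V) (hs : Simple V) (hd : dim V = 6) :
    V.card ≠ 13 ∧ V.card ≠ 14 := by
  by_contra! h
  have := hs.card_of_forall_simplex hV (by omega) fun F hF => by
    obtain ⟨h1, h2, h3⟩ := hs.facet_of_six hV hd hF
    obtain ⟨s, D, h4, h5, -, -, h6, h7, h8⟩ := hs.exists_count hV hF
    rw [hd] at h6 ⊢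
    rw [even_iff_exists_two_mul] at h1
    obtain ⟨k, hk⟩ := h1
    by_contra h6'
    have : s = 1 ∨ s = 2 ∨ s = 3 ∨ s = 4 := by omega
    rcases this with rfl | rfl | rfl | rfl <;> omega
  omega

theorem sum_eq_of_three_values {α : Type*} (s : Finset α) (f : α → ℕ) {p q r : ℕ} (hpq : p ≠ q)
    (hpr : p ≠ r) (hqr : q ≠ r) (h : ∀ x ∈ s, f x = p ∨ f x = q ∨ f x = r) :
    ∑ x ∈ s, f x = p * (s.filter fun x => f x = p).card + q * (s.filter fun x => f x = q).card +
        r * (s.filter fun x => f x = r).card ∧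
      s.card = (s.filter fun x => f x = p).card + (s.filter fun x => f x = q).card +
        (s.filter fun x => f x = r).card := by
  induction s using Finset.induction_on with
  | empty => simp
  | insert a s ha ih =>
    obtain ⟨h1, h2⟩ := ih fun x hx => h x (Finset.mem_insert_of_mem hx)
    rw [Finset.sum_insert ha, Finset.card_insert_of_notMem ha, h1, h2]
    rcases h a (Finset.mem_insert_self a s) with e | e | e <;>
      simp only [Finset.filter_insert, e, if_true, hpq, hpr, hqr, hpq.symm, hpr.symm, hqr.symm,
        if_false] <;>
      rw [Finset.card_insert_of_notMem (by simp [ha])] <;>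
      exact ⟨by ring, by ring⟩

theorem Simple.ridge_of_five (hV : ConvPos V) (hs : Simple V) (hd : dim V = 5) (hF : F ∈ facets V) :
    5 ≤ F.card ∧ F.card ≠ 6 ∧ F.card ≠ 7 := by
  have h1 := (hs.face hV (facet_isFace hF)).four_card_ne (hV.of_face (facet_isFace hF))
    (by have := facet_dim hF; omega)
  have h2 := le_card_facet hV (by omega) hF
  exact ⟨by omega, h1⟩

theorem Simple.card_facets_of_ten (hV : ConvPos V) (hs : Simple V) (hd : dim V = 5)
    (hc : V.card = 10) : (facets V).card = 7 := by
  have hval : ∀ F ∈ facets V, F.card = 5 ∨ F.card = 8 ∨ F.card = 0 := by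
    intro F hF
    obtain ⟨h1, h2, h3⟩ := hs.ridge_of_five hV hd hF
    obtain ⟨s, D, h4, h5, -, -, h6, h7, h8⟩ := hs.exists_count hV hF
    rw [hd] at h6
    have : s = 1 ∨ s = 2 ∨ s = 5 := by omega
    rcases this with rfl | rfl | rfl <;> omega
  obtain ⟨e1, e2⟩ := sum_eq_of_three_values (facets V) Finset.card (by norm_num) (by norm_num)
    (by norm_num) hval
  rw [sum_card_facets hV hs, hd, hc] at e1
  have e3 : ((facets V).filter fun F => F.card = 0).card = 0 := by
    rw [Finset.card_eq_zero, Finset.filter_eq_empty_iff]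
    intro F hF
    have := (hs.ridge_of_five hV hd hF).1
    omega
  by_contra hne
  have e4 : ((facets V).filter fun F => F.card = 8).card = 0 := by omega
  rw [Finset.card_eq_zero, Finset.filter_eq_empty_iff] at e4
  have := hs.card_of_forall_simplex hV (by omega) fun F hF => by
    have := hval F hF
    have := e4 hF
    have := (hs.ridge_of_five hV hd hF).1
    omega
  omega

theorem Simple.disjoint_of_simplex_facets (hV : ConvPos V) (hs : Simple V) (hd : 4 ≤ dim V)
    (hc : V.card ≠ dim V + 1) (hF : F ∈ facets V) (hG : G ∈ facets V) (hFG : F ≠ G)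
    (hFc : F.card = dim V) (hGc : G.card = dim V) : Disjoint F G := by
  by_contra h
  exact hc (hs.card_of_simplex_facets hV hd hF hG hFG (Finset.not_disjoint_iff_nonempty_inter.1 h)
    hFc hGc)

theorem Simple.card_facets_of_twelve (hV : ConvPos V) (hs : Simple V) (hd : dim V = 5)
    (hc : V.card = 12) : (facets V).card ≤ 7 := by
  have hval : ∀ F ∈ facets V, F.card = 5 ∨ F.card = 8 ∨ F.card = 9 := by
    intro F hF
    obtain ⟨h1, h2, h3⟩ := hs.ridge_of_five hV hd hF
    obtain ⟨s, D, h4, h5, -, -, h6, h7, h8⟩ := hs.exists_count hV hF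
    rw [hd] at h6
    have : s = 1 ∨ s = 2 ∨ s = 3 ∨ s = 4 ∨ s = 7 := by omega
    rcases this with rfl | rfl | rfl | rfl | rfl <;> omega
  obtain ⟨e1, e2⟩ := sum_eq_of_three_values (facets V) Finset.card (by norm_num) (by norm_num)
    (by norm_num) hval
  rw [sum_card_facets hV hs, hd, hc] at e1
  set Z := (facets V).filter fun F => F.card = 5 with hZ
  have hZmem : ∀ R ∈ Z, R ∈ facets V ∧ R.card = 5 := fun R hR => by
    simpa [hZ] using hR
  have hdisj : ∀ R ∈ Z, ∀ S ∈ Z, R ≠ S → Disjoint R S := fun R hR S hS hRS =>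
    hs.disjoint_of_simplex_facets hV (by omega) (by omega) (hZmem R hR).1 (hZmem S hS).1 hRS
      (by rw [hd, (hZmem R hR).2]) (by rw [hd, (hZmem S hS).2])
  have hZ2 : Z.card * 5 ≤ 12 := by
    rw [← hc, ← Finset.sum_const_nat (f := fun R => R.card) fun R hR => (hZmem R hR).2,
      ← Finset.card_biUnion hdisj]
    refine Finset.card_le_card (Finset.biUnion_subset.2 fun R hR => ?_)
    exact (facet_isFace (hZmem R hR).1).subset
  by_contra hn
  have hz : Z.card = 2 := by omega
  have hx : 0 < ((facets V).filter fun F => F.card = 9).card := by omega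
  obtain ⟨G, hG⟩ := Finset.card_pos.1 hx
  rw [Finset.mem_filter] at hG
  obtain ⟨hG, hG9⟩ := hG
  obtain ⟨R, S, hRS, hRSZ⟩ := Finset.card_eq_two.1 hz
  have hR : R ∈ Z := by simp [hRSZ]
  have hS : S ∈ Z := by simp [hRSZ]
  have hRSd := hdisj R hR S hS hRS
  obtain ⟨s, D, h4, h5, hs', hD, h6, h7, h8⟩ := hs.exists_count hV hG
  have hs3 : s = 3 := by omega
  subst hs3
  have hfull : ∀ x ∈ V \ G, ∀ y ∈ V \ G, y ≠ x → y ∈ nb V x := by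
    have hle : ∀ x ∈ V \ G, (nb V x ∩ (V \ G)).card ≤ 2 := fun x hx => by
      have := card_nb_inter_le (V := V) hx
      omega
    have heq : ∑ x ∈ V \ G, (nb V x ∩ (V \ G)).card = ∑ x ∈ V \ G, 2 := by
      rw [Finset.sum_const, hs', hD]
      rw [hd] at h6
      simp only [smul_eq_mul]
      omega
    intro x hx y hy hyx
    have h2 := (Finset.sum_eq_sum_iff_of_le hle).1 heq x hx
    have h3 : nb V x ∩ (V \ G) = (V \ G).erase x := by
      refine Finset.eq_of_subset_of_card_le (fun z hz => ?_) ?_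
      · rw [Finset.mem_inter] at hz
        exact Finset.mem_erase.2 ⟨(mem_nb.1 hz.1).2.1, hz.2⟩
      · rw [Finset.card_erase_of_mem hx, hs', h2]
    have h4 : y ∈ nb V x ∩ (V \ G) := by rw [h3]; exact Finset.mem_erase.2 ⟨hyx, hy⟩
    exact (Finset.mem_inter.1 h4).1
  have hex : ∀ R ∈ Z, ∃ u ∈ V \ G, u ∈ R := by
    intro R hR
    by_contra! h
    have hsub : R ⊆ G := fun z hz => by
      by_contra hzG
      exact h z (Finset.mem_sdiff.2 ⟨(facet_isFace (hZmem R hR).1).subset hz, hzG⟩) hz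
    have := facet_eq_of_subset (hZmem R hR).1 hG (facet_nonempty (by omega) (hZmem R hR).1) hsub
    have := (hZmem R hR).2
    simp_all
  obtain ⟨u, hu, huR⟩ := hex R hR
  obtain ⟨u', hu', huS⟩ := hex S hS
  have huS' : u ∉ S := Finset.disjoint_left.1 hRSd huR
  have huR' : u' ∉ R := fun h => Finset.disjoint_left.1 hRSd h huS
  have huu : u ≠ u' := by rintro rfl; exact huS' huS
  obtain ⟨t, ht, htn⟩ : ∃ t ∈ V \ G, t ∉ ({u, u'} : Finset E) := by
    by_contra! h
    have := (Finset.card_le_card h).trans Finset.card_le_two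
    omega
  rw [Finset.mem_insert, Finset.mem_singleton, not_or] at htn
  have htR : t ∈ R := by
    by_contra htR
    exact htn.2 (eq_of_mem_nb_sdiff (card_nb_sdiff_of_simple hV (hs u (Finset.mem_sdiff.1 hu).1)
      (hZmem R hR).1 huR) (hfull u hu t ht htn.1) htR (hfull u hu u' hu' huu.symm) huR')
  have htS : t ∈ S := by
    by_contra htS
    exact htn.1 (eq_of_mem_nb_sdiff (card_nb_sdiff_of_simple hV (hs u' (Finset.mem_sdiff.1 hu').1)
      (hZmem S hS).1 huS) (hfull u' hu' t ht htn.2) htS (hfull u' hu' u hu huu) huS')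
  exact Finset.disjoint_left.1 hRSd htR htS

/-- A facet with few vertices outside which are densely connected bounds the number of facets. -/
theorem Simple.card_facets_le_of_dense (hV : ConvPos V) (hs : Simple V) (hd : 2 ≤ dim V)
    (hF : F ∈ facets V) {r : ℕ} (hr : (V \ F).card = r) (hr45 : r = 4 ∨ r = 5)
    (hD : r * (r - 2) < ∑ x ∈ V \ F, (nb V x ∩ (V \ F)).card)
    (hD' : 2 * (r - 1) + (r - 3) * (r - 2) < ∑ x ∈ V \ F, (nb V x ∩ (V \ F)).card) :
    (facets V).card ≤ dim V + 2 := by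
  set X := V \ F with hX
  have hXV : X ⊆ V := Finset.sdiff_subset
  obtain ⟨z, hz, hzd⟩ : ∃ z ∈ X, r - 2 < (nb V z ∩ X).card := by
    by_contra! h
    have := Finset.sum_le_card_nsmul _ _ _ h
    rw [smul_eq_mul, hr] at this
    omega
  have hdom : ∀ x ∈ X, x ≠ z → x ∈ nb V z := by
    intro x hx hxz
    have h3 : nb V z ∩ X = X.erase z := by
      refine Finset.eq_of_subset_of_card_le (fun y hy => ?_) ?_
      · rw [Finset.mem_inter] at hy
        exact Finset.mem_erase.2 ⟨(mem_nb.1 hy.1).2.1, hy.2⟩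
      · rw [Finset.card_erase_of_mem hz, hr]
        omega
    have h4 : x ∈ nb V z ∩ X := by rw [h3]; exact Finset.mem_erase.2 ⟨hxz, hx⟩
    exact (Finset.mem_inter.1 h4).1
  have hmeet : ∀ T ∈ facets V, T ≠ F → ∃ x ∈ T, x ∈ X := by
    intro T hT hTF
    by_contra! h
    exact hTF (facet_eq_of_subset hT hF (facet_nonempty hd hT) fun y hy => by
      by_contra hyF
      exact h y hy (Finset.mem_sdiff.2 ⟨(facet_isFace hT).subset hy, hyF⟩))
  have hone : ((facets V).filter fun T => T ≠ F ∧ z ∉ T).card ≤ 1 := by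
    rw [Finset.card_le_one]
    intro T hT S hS
    rw [Finset.mem_filter] at hT hS
    obtain ⟨hT, hTF, hzT⟩ := hT
    obtain ⟨hS, hSF, hzS⟩ := hS
    obtain ⟨x, hxT, hxX⟩ := hmeet T hT hTF
    obtain ⟨y, hyS, hyX⟩ := hmeet S hS hSF
    have hxz : x ≠ z := by rintro rfl; exact hzT hxT
    have hyz : y ≠ z := by rintro rfl; exact hzS hyS
    have huniq : ∀ a ∈ X, a ≠ z → a ∈ T → a ∈ S → T = S := fun a ha haz haT haS =>
      facet_unique hV (hs a (hXV ha)) hT hS haT haS (mem_nb_comm (hXV hz) (hdom a ha haz)) hzT hzS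
    have hin : ∀ T ∈ facets V, z ∉ T → ∀ a ∈ T, a ∈ X → ∀ b ∈ nb V a, b ≠ z → b ∈ T := by
      intro T hT hzT a haT haX b hb hbz
      by_contra hbT
      have haz : a ≠ z := by rintro rfl; exact hzT haT
      exact hbz (eq_of_mem_nb_sdiff (card_nb_sdiff_of_simple hV (hs a (hXV haX)) hT haT) hb hbT
        (mem_nb_comm (hXV hz) (hdom a haX haz)) hzT)
    by_cases hxy : x = y
    · subst hxy
      exact huniq x hxX hxz hxT hyS
    by_cases hadj : y ∈ nb V x
    · exact huniq y hyX hyz (hin T hT hzT x hxT hxX y hadj hyz) hyS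
    have hadj' : x ∉ nb V y := fun h => hadj (mem_nb_comm (hXV hyX) h)
    by_cases hcom : ∃ a ∈ X, a ≠ z ∧ a ∈ nb V x ∧ a ∈ nb V y
    · obtain ⟨a, haX, haz, hax, hay⟩ := hcom
      exact huniq a haX haz (hin T hT hzT x hxT hxX a hax haz) (hin S hS hzS y hyS hyX a hay haz)
    exfalso
    push Not at hcom
    have hxyz : ({x, y, z} : Finset E) ⊆ X := by
      simp [Finset.insert_subset_iff, hxX, hyX, hz]
    have hcard3 : ({x, y, z} : Finset E).card = 3 := by
      rw [Finset.card_insert_of_notMem (by simp [hxy, hxz]), Finset.card_pair hyz]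
    have hsum : ∑ a ∈ X, (nb V a ∩ X).card = ((nb V x ∩ X).card + ((nb V y ∩ X).card +
        (nb V z ∩ X).card)) + ∑ a ∈ X \ {x, y, z}, (nb V a ∩ X).card := by
      rw [← Finset.sum_sdiff hxyz, Finset.sum_insert (by simp [hxy, hxz]), Finset.sum_pair hyz,
        add_comm]
    have hzc := card_nb_inter_le (V := V) hz
    have hAB : (nb V x ∩ X).card + (nb V y ∩ X).card ≤ r - 1 := by
      rw [← Finset.card_union_add_card_inter]
      have h1 : (nb V x ∩ X ∪ nb V y ∩ X).card + 2 ≤ r := by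
        have : (nb V x ∩ X ∪ nb V y ∩ X) ⊆ X \ {x, y} := by
          intro a ha
          simp only [Finset.mem_union, Finset.mem_inter, Finset.mem_sdiff, Finset.mem_insert,
            Finset.mem_singleton] at ha ⊢
          have h1 := notMem_nb_self (V := V) (v := x)
          have h2 := notMem_nb_self (V := V) (v := y)
          refine ⟨by tauto, ?_⟩
          rintro (rfl | rfl) <;> tauto
        have h2 := Finset.card_le_card this
        rw [Finset.card_sdiff_of_subset (by simp [Finset.insert_subset_iff, hxX, hyX]),
          Finset.card_pair hxy] at h2
        omega
      have h2 : ((nb V x ∩ X) ∩ (nb V y ∩ X)).card ≤ 1 := by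
        rw [Finset.card_le_one_iff_subset_singleton]
        refine ⟨z, fun a ha => ?_⟩
        simp only [Finset.mem_inter] at ha
        rw [Finset.mem_singleton]
        by_contra haz
        exact hcom a ha.1.2 haz ha.1.1 ha.2.1
      omega
    have hrest : ∑ a ∈ X \ {x, y, z}, (nb V a ∩ X).card ≤ (r - 3) * (r - 2) := by
      rw [← hr, ← hcard3, ← Finset.card_sdiff_of_subset hxyz, ← smul_eq_mul]
      refine Finset.sum_le_card_nsmul _ _ _ fun a ha => ?_
      simp only [Finset.mem_sdiff, Finset.mem_insert, Finset.mem_singleton, not_or] at ha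
      obtain ⟨haX, hax, hay, haz⟩ := ha
      obtain ⟨b, hb, hbX, hba⟩ : ∃ b, b ∉ nb V a ∧ b ∈ X ∧ b ≠ a := by
        by_cases h : x ∈ nb V a
        · exact ⟨y, fun h' => hcom a haX haz (mem_nb_comm (hXV haX) h)
            (mem_nb_comm (hXV haX) h'), hyX, Ne.symm hay⟩
        · exact ⟨x, h, hxX, Ne.symm hax⟩
      have : nb V a ∩ X ⊆ X \ {a, b} := by
        intro c hc
        rw [Finset.mem_inter] at hc
        simp only [Finset.mem_sdiff, Finset.mem_insert, Finset.mem_singleton, not_or]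
        refine ⟨hc.2, ?_, ?_⟩
        · rintro rfl
          exact notMem_nb_self hc.1
        · rintro rfl
          exact hb hc.1
      refine (Finset.card_le_card this).trans ?_
      rw [Finset.card_sdiff_of_subset (by simp [Finset.insert_subset_iff, haX, hbX]),
        Finset.card_pair hba.symm]
    rcases hr45 with rfl | rfl <;> omega
  have hcov : facets V ⊆ {F} ∪ ((facets V).filter fun T => z ∈ T) ∪
      ((facets V).filter fun T => T ≠ F ∧ z ∉ T) := by
    intro T hT
    by_cases h1 : T = F
    · simp [h1]
    · by_cases h2 : z ∈ T <;> simp [hT, h1, h2]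
  have h1 := Finset.card_le_card hcov
  have h2 := Finset.card_union_le ({F} ∪ ((facets V).filter fun T => z ∈ T))
    ((facets V).filter fun T => T ≠ F ∧ z ∉ T)
  have h3 := Finset.card_union_le {F} ((facets V).filter fun T => z ∈ T)
  rw [Finset.card_singleton, card_facets_at hV (hXV hz) (hs z (hXV hz))] at h3
  omega

theorem Simple.six_card_ne' (hV : ConvPos V) (hs : Simple V) (hd : dim V = 6) :
    V.card ≠ 18 ∧ V.card ≠ 19 := by
  by_contra! hc
  replace hc : V.card = 18 ∨ V.card = 19 := by omega
  have hdF : ∀ F ∈ facets V, dim F = 5 := fun F hF => by have := facet_dim hF; omega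
  have hVF : ∀ F ∈ facets V, ConvPos F := fun F hF => hV.of_face (facet_isFace hF)
  have hsF : ∀ F ∈ facets V, Simple F := fun F hF => hs.face hV (facet_isFace hF)
  have h16 : ∀ F ∈ facets V, F.card ≠ 14 := by
    intro F hF h14
    obtain ⟨s, D, h4, h5, h9, h10, h6, h7, h8⟩ := hs.exists_count hV hF
    rw [hd] at h6
    have hs45 : s = 4 ∨ s = 5 := by omega
    have := hs.card_facets_le_of_dense hV (by omega) hF h9 hs45
      (by rcases hs45 with rfl | rfl <;> omega) (by rcases hs45 with rfl | rfl <;> omega)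
    have := hs.six_card_le hV hd (by omega)
    omega
  have hval : ∀ F ∈ facets V, F.card = 6 ∨ F.card = 10 ∨ F.card = 12 := by
    intro F hF
    obtain ⟨h1, h2, h3⟩ := hs.facet_of_six hV hd hF
    obtain ⟨s, D, h4, h5, -, -, h6, h7, h8⟩ := hs.exists_count hV hF
    have := h16 F hF
    rw [hd] at h6
    rw [even_iff_exists_two_mul] at h1
    obtain ⟨k, hk⟩ := h1
    by_contra! hn
    have : s = 1 ∨ s = 2 ∨ s = 3 := by omega
    rcases this with rfl | rfl | rfl <;> omega
  obtain ⟨e1, e2⟩ := sum_eq_of_three_values (facets V) Finset.card (by norm_num) (by norm_num)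
    (by norm_num) hval
  rw [sum_card_facets hV hs, hd] at e1
  have hsub : ∀ {F G}, F ∈ facets V → G ∈ (facets V).filter (fun G => Disjoint F G) →
      G ∈ facets V ∧ G ⊆ V \ F := by
    intro F G hF hG
    rw [Finset.mem_filter] at hG
    exact ⟨hG.1, fun x hx => Finset.mem_sdiff.2 ⟨(facet_isFace hG.1).subset hx,
      fun h => Finset.disjoint_left.1 hG.2 h hx⟩⟩
  have h12 : ∀ F ∈ facets V, F.card ≠ 12 := by
    intro F hF hF12
    obtain ⟨s, D, h4, h5, h9, h10, h6, h7, h8⟩ := hs.exists_count hV hF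
    rw [hd] at h6
    have h1 := card_facets_le_add_disjoint hV hs hF
    have h2 := (hsF F hF).card_facets_of_twelve (hVF F hF) (hdF F hF) hF12
    obtain ⟨G, hG⟩ := Finset.card_pos.1
      (by omega : 0 < ((facets V).filter fun G => Disjoint F G).card)
    obtain ⟨hG, hGX⟩ := hsub hF hG
    have hG6 : G.card = 6 := by
      have := Finset.card_le_card hGX
      have := hval G hG
      omega
    have hGsum : ∑ x ∈ G, (nb V x ∩ (V \ F)).card ≥ 30 := by
      have : ∀ x ∈ G, 5 ≤ (nb V x ∩ (V \ F)).card := by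
        intro x hx
        rw [← hdF G hG, ← hsF G hG x hx, nb_face (facet_isFace hG) hx]
        exact Finset.card_le_card (Finset.inter_subset_inter_left hGX)
      have := Finset.card_nsmul_le_sum _ _ _ this
      rw [hG6] at this
      simpa using this
    have hXsum := Finset.sum_sdiff (f := fun x => (nb V x ∩ (V \ F)).card) hGX
    rcases hc with hc | hc
    · omega
    · obtain ⟨y, hy⟩ := Finset.card_pos.1 (by
        rw [Finset.card_sdiff_of_subset hGX]
        omega : 0 < ((V \ F) \ G).card)
      have h3 := Finset.single_le_sum (f := fun x => (nb V x ∩ (V \ F)).card)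
        (fun i _ => Nat.zero_le _) hy
      have h4 := one_le_card_nb_inter hV (facet_isFace hF) (by omega) (Finset.mem_sdiff.1 hy).1
      omega
  have e3 : ((facets V).filter fun F => F.card = 12).card = 0 := by
    rw [Finset.card_eq_zero, Finset.filter_eq_empty_iff]
    exact fun F hF => h12 F hF
  obtain ⟨F, hF, hF10⟩ : ∃ F ∈ facets V, F.card ≠ 6 := by
    by_contra! h
    have := hs.card_of_forall_simplex hV (by omega) (by rwa [hd])
    omega
  have hF10 : F.card = 10 := by
    have := hval F hF
    have := h12 F hF
    omega
  obtain ⟨s, D, h4, h5, h9, h10, h6, h7, h8⟩ := hs.exists_count hV hF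
  have h1 := card_facets_le_add_disjoint hV hs hF
  rw [(hsF F hF).card_facets_of_ten (hVF F hF) (hdF F hF) hF10] at h1
  obtain ⟨G, hG, H, hH, hGH⟩ := Finset.one_lt_card.1
    (by omega : 1 < ((facets V).filter fun G => Disjoint F G).card)
  obtain ⟨hG, hGX⟩ := hsub hF hG
  obtain ⟨hH, hHX⟩ := hsub hF hH
  have h6' : ∀ G ∈ facets V, G ⊆ V \ F → G.card = 6 := by
    intro G hG hGX
    have := Finset.card_le_card hGX
    have := hval G hG
    omega
  have hdis := hs.disjoint_of_simplex_facets hV (by omega) (by omega) hG hH hGH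
    (by rw [hd, h6' G hG hGX]) (by rw [hd, h6' H hH hHX])
  have := Finset.card_le_card (Finset.union_subset hGX hHX)
  rw [Finset.card_union_of_disjoint hdis, h6' G hG hGX, h6' H hH hHX] at this
  omega

end SimplePolytopes

section Excess

variable {E : Type*} [AddCommGroup E] [Module ℝ E] {V F G H R : Finset E} {v w x : E}

/-- The excess degree of the graph of `V`. -/
noncomputable def exc (V : Finset E) : ℕ := ∑ v ∈ V, ((nb V v).card - dim V)

/-- Any two intersecting facets meet in a ridge. -/
def Semi (V : Finset E) : Prop :=
  ∀ F ∈ facets V, ∀ G ∈ facets V, F ≠ G → (F ∩ G).Nonempty → dim (F ∩ G) + 2 = dim V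

theorem sum_card_nb_eq_exc (hV : ConvPos V) :
    ∑ v ∈ V, (nb V v).card = exc V + dim V * V.card := by
  rw [exc, mul_comm, ← smul_eq_mul, ← Finset.sum_const, ← Finset.sum_add_distrib]
  exact Finset.sum_congr rfl fun v hv => (Nat.sub_add_cancel (dim_le_card_nb hV hv)).symm

theorem simple_of_exc_eq_zero (hV : ConvPos V) (h : exc V = 0) : Simple V := by
  intro v hv
  have h1 := Finset.sum_eq_zero_iff.1 h v hv
  have h2 := dim_le_card_nb hV hv
  omega

theorem exc_eq_zero_of_simple (h : Simple V) : exc V = 0 :=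
  Finset.sum_eq_zero fun v hv => by rw [h v hv, Nat.sub_self]

theorem exc_eq_add (hV : ConvPos V) (hF : F ∈ facets V) :
    exc V = exc F + ∑ x ∈ F, ((nb V x \ F).card - 1) + ∑ x ∈ V \ F, ((nb V x).card - dim V) := by
  rw [exc, exc, ← Finset.sum_sdiff (facet_isFace hF).subset, add_comm, ← Finset.sum_add_distrib]
  congr 1
  refine Finset.sum_congr rfl fun x hx => ?_
  have h1 := card_nb_face_add (facet_isFace hF) hx
  have h2 := one_le_card_nb_sdiff hV hF hx
  have h3 := dim_le_card_nb (hV.of_face (facet_isFace hF)) hx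
  have := facet_dim hF
  omega

/-- If every facet at a vertex misses exactly one neighbour, the vertex has degree `dim V`. -/
theorem card_nb_eq_of_facets (hV : ConvPos V) (hv : v ∈ V)
    (h : ∀ F ∈ facets V, v ∈ F → (nb V v \ F).card = 1) : (nb V v).card = dim V := by
  have key : ∀ S ⊆ nb V v, ∃ K, IsFace V K ∧ v ∈ K ∧ (∀ u ∈ nb V v, u ∈ K ↔ u ∉ S) ∧
      dim K + S.card ≤ dim V := by
    intro S
    induction S using Finset.induction_on with
    | empty => exact fun _ => ⟨V, isFace_self V, hv, fun u hu => by simp [nb_subset hu], by simp⟩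
    | insert w S hwS ih =>
      intro hS
      rw [Finset.insert_subset_iff] at hS
      obtain ⟨K, h1, h2, h3, h4⟩ := ih hS.2
      obtain ⟨G, hG, hvG, hwG⟩ := exists_facet_of_nb hV hv hS.1
      have h5 : v ∈ K ∩ G := Finset.mem_inter.2 ⟨h2, hvG⟩
      have h6 := h1.inter (facet_isFace hG)
      refine ⟨K ∩ G, h6, h5, fun u hu => ?_, ?_⟩
      · rw [Finset.mem_inter, Finset.mem_insert, h3 u hu, not_or, and_comm]
        refine and_congr_left fun _ => ⟨?_, fun hne => ?_⟩
        · rintro huG rfl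
          exact hwG huG
        · by_contra huG
          exact hne (eq_of_mem_nb_sdiff (h G hG hvG) hu huG hS.1 hwG)
      · have h7 : K ∩ G ⊂ K := ⟨Finset.inter_subset_left, fun hsub =>
          hwG (Finset.mem_inter.1 (hsub ((h3 w hS.1).2 hwS))).2⟩
        have := dim_lt_of_ssubset (h6.restrict h7.subset h1.subset) ⟨v, h5⟩ h7
        rw [Finset.card_insert_of_notMem hwS]
        omega
  obtain ⟨K, -, -, -, h4⟩ := key _ subset_rfl
  have := dim_le_card_nb hV hv
  omega

theorem Semi.card_nb_of_facet (hV : ConvPos V) (hS : Semi V) (hF : F ∈ facets V) (hv : v ∈ F)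
    (hs : (nb F v).card = dim F) : (nb V v).card = dim V := by
  by_contra hne
  have h1 := card_nb_face_add (facet_isFace hF) hv
  have h2 := facet_dim hF
  have hFV := (facet_isFace hF).subset
  have h3 := dim_le_card_nb hV (hFV hv)
  obtain ⟨w, hw, w', hw', hww⟩ := Finset.one_lt_card.1 (by omega : 1 < (nb V v \ F).card)
  rw [Finset.mem_sdiff] at hw hw'
  have hvF : ∀ {u}, u ∈ nb V v → u ≠ v := fun h => (mem_nb.1 h).2.1
  obtain ⟨T, hT, hwT, hw'T⟩ := exists_facet (mem_nb.1 hw.1).2.2 (by simp) (nb_subset hw'.1)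
    (by simp [hvF hw'.1, hww.symm])
  have hvT : v ∈ T := hwT (by simp)
  have hridge : ∀ T ∈ facets V, v ∈ T → T ≠ F → dim (F ∩ T) + 2 = dim V := fun T hT hvT hTF =>
    hS F hF T hT hTF.symm ⟨v, Finset.mem_inter.2 ⟨hv, hvT⟩⟩
  have hTF : T ≠ F := by
    rintro rfl
    exact hw.2 (hwT (by simp))
  have hTd := hridge T hT hvT hTF
  have hVF := hV.of_face (facet_isFace hF)
  have hTf := inter_mem_facets hF hT hTd
  obtain ⟨u, hu⟩ := Finset.card_pos.1
    (one_le_card_nb_sdiff hVF hTf (Finset.mem_inter.2 ⟨hv, hvT⟩))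
  rw [Finset.mem_sdiff] at hu
  have huV : u ∈ nb V v := by
    have := hu.1
    rw [nb_face (facet_isFace hF) hv] at this
    exact (Finset.mem_inter.1 this).1
  have huF : u ∈ F := nb_subset hu.1
  obtain ⟨T', hT', hwT', huT'⟩ := exists_facet (mem_nb.1 hw'.1).2.2 (by simp) (nb_subset huV)
    (by
      simp only [Finset.mem_insert, Finset.mem_singleton, not_or]
      exact ⟨hvF huV, by rintro rfl; exact hw'.2 huF⟩)
  have hvT' : v ∈ T' := hwT' (by simp)
  have hTF' : T' ≠ F := by
    rintro rfl
    exact huT' huF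
  have hTd' := hridge T' hT' hvT' hTF'
  have heq : F ∩ T' = F ∩ T := facet_unique hVF hs (inter_mem_facets hF hT' hTd') hTf
    (Finset.mem_inter.2 ⟨hv, hvT'⟩) (Finset.mem_inter.2 ⟨hv, hvT⟩) hu.1
    (fun h => huT' (Finset.mem_inter.1 h).2) hu.2
  have : T' = T := facets_through_ridge ((facet_isFace hF).inter (facet_isFace hT))
    ⟨v, Finset.mem_inter.2 ⟨hv, hvT⟩⟩ hTd hF hT hT' Finset.inter_subset_left
    Finset.inter_subset_right (heq ▸ Finset.inter_subset_right) hTF.symm hTF'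
  exact hw'T (this ▸ hwT' (by simp))

theorem card_nb_of_dim_two (hV : ConvPos V) (hd : dim V = 2) (hv : v ∈ V) :
    (nb V v).card = 2 := by
  have h1 := dim_le_card_nb hV hv
  rw [hd] at h1
  refine le_antisymm (not_lt.1 fun h => ?_) h1
  obtain ⟨a, b, c, ha, hb, hc, hab, hac, hbc⟩ := Finset.two_lt_card_iff.1 h
  have hf : ∀ u ∈ nb V v, {v, u} ∈ facets V := by
    intro u hu
    rw [mem_nb] at hu
    have h2 := dim_lt_card (hV.of_face hu.2.2) (by simp)
    rw [Finset.card_pair hu.2.1.symm] at h2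
    have h3 := dim_lt_of_ssubset ((hV v hv).restrict (by simp) hu.2.2.subset) (by simp)
      (⟨by simp, fun h => hu.2.1 (by simpa using h (by simp : u ∈ ({v, u} : Finset E)))⟩ :
        ({v} : Finset E) ⊂ {v, u})
    exact mem_facets.2 ⟨hu.2.2, by omega⟩
  have hne : ∀ {u u'}, u ∈ nb V v → u ≠ u' → ({v, u} : Finset E) ≠ {v, u'} := by
    intro u u' hu huu h
    have : u ∈ ({v, u'} : Finset E) := by rw [← h]; simp
    simp [(mem_nb.1 hu).2.1, huu] at this
  refine hne hc hbc.symm (facets_through_ridge (hV v hv) (by simp) (by simp [dim_singleton, hd])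
    (hf a ha) (hf b hb) (hf c hc) (by simp) (by simp) (by simp) (hne ha hab) (hne hc hac.symm))

theorem card_nb_inter_add_le (hF : F ∈ facets V) (hG : G ∈ facets V) (hv : v ∈ F ∩ G) :
    (nb (F ∩ G) v).card + (nb F v \ (F ∩ G)).card + (nb G v \ (F ∩ G)).card =
      (nb V v ∩ (F ∪ G)).card := by
  have hvF := (Finset.mem_inter.1 hv).1
  have hvG := (Finset.mem_inter.1 hv).2
  rw [nb_face ((facet_isFace hF).inter (facet_isFace hG)) hv, nb_face (facet_isFace hF) hvF,
    nb_face (facet_isFace hG) hvG, ← Finset.card_union_of_disjoint, ← Finset.card_union_of_disjoint]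
  · congr 1
    ext y
    simp only [Finset.mem_union, Finset.mem_inter, Finset.mem_sdiff]
    tauto
  · rw [Finset.disjoint_left]
    intro y
    simp only [Finset.mem_union, Finset.mem_inter, Finset.mem_sdiff]
    tauto
  · rw [Finset.disjoint_left]
    intro y
    simp only [Finset.mem_inter, Finset.mem_sdiff]
    tauto

theorem inter_bounds (hV : ConvPos V) (hF : F ∈ facets V) (hG : G ∈ facets V) (hv : v ∈ F ∩ G) :
    dim V ≤ dim (F ∩ G) + (nb F v \ (F ∩ G)).card + 1 ∧
    dim V ≤ dim (F ∩ G) + (nb G v \ (F ∩ G)).card + 1 ∧ dim (F ∩ G) ≤ (nb (F ∩ G) v).card := by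
  have hK := (facet_isFace hF).inter (facet_isFace hG)
  have h1 := dim_le_dim_add_card (hV.of_face (facet_isFace hF))
    (hK.restrict Finset.inter_subset_left (facet_isFace hF).subset) hv
  have h2 := dim_le_dim_add_card (hV.of_face (facet_isFace hG))
    (hK.restrict Finset.inter_subset_right (facet_isFace hG).subset) hv
  have h3 := dim_le_card_nb (hV.of_face hK) hv
  have := facet_dim hF
  have := facet_dim hG
  omega

theorem le_card_nb_sub_of_inter (hV : ConvPos V) (hF : F ∈ facets V) (hG : G ∈ facets V)
    (hv : v ∈ F ∩ G) : dim V - 2 - dim (F ∩ G) ≤ (nb V v).card - dim V := by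
  obtain ⟨h1, h2, h3⟩ := inter_bounds hV hF hG hv
  have h4 := card_nb_inter_add_le hF hG hv
  have h5 : (nb V v ∩ (F ∪ G)).card ≤ (nb V v).card := Finset.card_le_card Finset.inter_subset_left
  omega

theorem mul_le_exc_of_inter (hV : ConvPos V) (hF : F ∈ facets V) (hG : G ∈ facets V) :
    (F ∩ G).card * (dim V - 2 - dim (F ∩ G)) ≤ exc V := by
  have hsub : F ∩ G ⊆ V := Finset.inter_subset_left.trans (facet_isFace hF).subset
  rw [← smul_eq_mul]
  exact (Finset.card_nsmul_le_sum _ _ _ fun v hv => le_card_nb_sub_of_inter hV hF hG hv).trans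
    (Finset.sum_le_sum_of_subset hsub)

theorem exists_of_not_semi (h : ¬ Semi V) : ∃ F ∈ facets V, ∃ G ∈ facets V, F ≠ G ∧
    (F ∩ G).Nonempty ∧ dim (F ∩ G) + 3 ≤ dim V := by
  simp only [Semi, not_forall] at h
  obtain ⟨F, hF, G, hG, hFG, hne, h⟩ := h
  have := dim_inter_add_two_le hF hG hFG hne
  exact ⟨F, hF, G, hG, hFG, hne, by omega⟩

theorem le_exc_of_not_semi (hV : ConvPos V) (h : ¬ Semi V) : dim V - 2 ≤ exc V := by
  obtain ⟨F, hF, G, hG, -, hne, hd⟩ := exists_of_not_semi h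
  have h1 := mul_le_exc_of_inter hV hF hG
  have h2 := dim_lt_card (hV.of_face ((facet_isFace hF).inter (facet_isFace hG))) hne
  obtain ⟨b, hb⟩ := Nat.exists_eq_add_of_le hd
  have h3 : dim V - 2 - dim (F ∩ G) = b + 1 := by omega
  rw [h3] at h1
  nlinarith [Nat.sub_le (dim V) 2, (by omega : dim V - 2 = dim (F ∩ G) + b + 1),
    Nat.mul_le_mul_right (b + 1) h2]

theorem exists_facet_mem (hV : ConvPos V) (hd : 1 ≤ dim V) (hv : v ∈ V) :
    ∃ F ∈ facets V, v ∈ F := by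
  obtain ⟨w, hw⟩ := Finset.card_pos.1 (hd.trans (dim_le_card_nb hV hv))
  obtain ⟨G, hG, h, -⟩ := exists_facet_of_nb hV hv hw
  exact ⟨G, hG, h⟩

theorem Semi.simple_of_dim_three (hV : ConvPos V) (hS : Semi V) (hd : dim V = 3) : Simple V := by
  intro v hv
  obtain ⟨F, hF, hvF⟩ := exists_facet_mem hV (by omega) hv
  have h := facet_dim hF
  refine hS.card_nb_of_facet hV hF hvF ?_
  rw [card_nb_of_dim_two (hV.of_face (facet_isFace hF)) (by omega) hvF]
  omega

theorem Semi.card_nb_ne (hV : ConvPos V) (hS : Semi V) (hv : v ∈ V) :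
    (nb V v).card ≠ dim V + 1 := by
  intro h
  have := card_nb_eq_of_facets hV hv fun F hF hvF => by
    have h1 := card_nb_face_add (facet_isFace hF) hvF
    have h2 := one_le_card_nb_sdiff hV hF hvF
    have h3 := dim_le_card_nb (hV.of_face (facet_isFace hF)) hvF
    have h4 := facet_dim hF
    have h5 : (nb F v).card ≠ dim F := fun e => by
      have := hS.card_nb_of_facet hV hF hvF e
      omega
    omega
  omega

theorem exc_le_of_unique (hv : v ∈ V) (h : ∀ x ∈ V, x ≠ v → (nb V x).card = dim V) :
    exc V = (nb V v).card - dim V :=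
  Finset.sum_eq_single_of_mem v hv fun x hx hxv => by rw [h x hx hxv, Nat.sub_self]

theorem Semi.le_exc_of_unique (hV : ConvPos V) (hS : Semi V) (hd : 4 ≤ dim V)
    (ih : ∀ F ∈ facets V, ¬ Simple F → dim F - 2 ≤ exc F ∧ (Semi F → dim F - 1 ≤ exc F))
    (hv : v ∈ V) (hvs : (nb V v).card ≠ dim V)
    (h : ∀ x ∈ V, x ≠ v → (nb V x).card = dim V) : dim V - 1 ≤ exc V := by
  by_contra hcon
  rw [exc_le_of_unique hv h] at hcon
  have hVF : ∀ F ∈ facets V, ConvPos F := fun F hF => hV.of_face (facet_isFace hF)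
  have hFexc : ∀ F ∈ facets V, v ∈ F → exc F = (nb F v).card - dim F := fun F hF hvF =>
    exc_le_of_unique hvF fun x hx hxv => card_nb_face_of_simple hV
      (h x ((facet_isFace hF).subset hx) hxv) (facet_isFace hF) hx
  have hFns : ∀ F ∈ facets V, v ∈ F → ¬ Simple F := fun F hF hvF hs =>
    hvs (hS.card_nb_of_facet hV hF hvF (hs v hvF))
  have hFnb : ∀ F ∈ facets V, v ∈ F → 2 * dim V ≤ (nb F v).card + 4 := by
    intro F hF hvF
    have h1 := (ih F hF (hFns F hF hvF)).1
    rw [hFexc F hF hvF] at h1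
    have := facet_dim hF
    omega
  have hmiss : ∀ F ∈ facets V, v ∈ F → (nb V v \ F).card ≤ 2 := by
    intro F hF hvF
    have := hFnb F hF hvF
    have := card_nb_face_add (facet_isFace hF) hvF
    omega
  obtain ⟨F, hF, hvF, hF2⟩ : ∃ F ∈ facets V, v ∈ F ∧ (nb V v \ F).card ≠ 1 := by
    by_contra! h
    exact hvs (card_nb_eq_of_facets hV hv h)
  have hFd := facet_dim hF
  have hFf := facet_isFace hF
  have h1 := one_le_card_nb_sdiff hV hF hvF
  have h2 := hmiss F hF hvF
  have h3 := hFnb F hF hvF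
  have h4 := card_nb_face_add hFf hvF
  have hnS : ¬ Semi F := by
    intro hSF
    have h5 := (ih F hF (hFns F hF hvF)).2 hSF
    rw [hFexc F hF hvF] at h5
    omega
  obtain ⟨R₁, hR₁, R₂, hR₂, hR₁₂, ⟨u, hu⟩, hdK⟩ := exists_of_not_semi hnS
  have hK : ∀ u ∈ R₁ ∩ R₂, u = v := by
    intro u hu
    by_contra huv
    have := le_card_nb_sub_of_inter (hVF F hF) hR₁ hR₂ hu
    have := card_nb_face_of_simple hV (h u (hFf.subset ((facet_isFace hR₁).subset
      (Finset.mem_inter.1 hu).1)) huv) hFf ((facet_isFace hR₁).subset (Finset.mem_inter.1 hu).1)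
    omega
  have huv := hK u hu
  subst huv
  have hKu : R₁ ∩ R₂ = {u} := Finset.eq_singleton_iff_unique_mem.2 ⟨hu, hK⟩
  have hu' := Finset.mem_inter.1 hu
  have h6 := card_nb_inter_add_le hR₁ hR₂ hu
  have h7 : (nb F u ∩ (R₁ ∪ R₂)).card ≤ (nb F u).card := Finset.card_le_card Finset.inter_subset_left
  obtain ⟨h8, h9, -⟩ := inter_bounds (hVF F hF) hR₁ hR₂ hu
  have hd0 : dim (R₁ ∩ R₂) = 0 := by rw [hKu, dim_singleton]
  have h10 : (nb R₁ u).card = (nb R₁ u \ (R₁ ∩ R₂)).card := by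
    congr 1
    rw [hKu, Finset.sdiff_singleton_eq_erase, Finset.erase_eq_of_notMem notMem_nb_self]
  have h11 := card_nb_face_add (facet_isFace hR₁) hu'.1
  have hother : ∀ R ∈ facets F, u ∈ R → ∃ G ∈ facets V, u ∈ G ∧ F ∩ G = R ∧
      nb F u \ R ⊆ nb V u \ G := by
    intro R hR huR
    obtain ⟨G, hG, -, hFG⟩ := exists_other_facet hF hR ⟨u, huR⟩
    refine ⟨G, hG, (Finset.mem_inter.1 (hFG ▸ huR)).2, hFG, fun y hy => ?_⟩
    rw [nb_face hFf hvF, Finset.mem_sdiff, Finset.mem_inter] at hy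
    refine Finset.mem_sdiff.2 ⟨hy.1.1, fun hyG => hy.2 ?_⟩
    rw [← hFG]
    exact Finset.mem_inter.2 ⟨hy.1.2, hyG⟩
  obtain ⟨G, hG, huG, hFG, hGsub⟩ := hother R₁ hR₁ hu'.1
  have h12 := Finset.card_le_card hGsub
  have h13 := hmiss G hG huG
  have hd4 : dim V = 4 := by omega
  have hout : ∀ G ∈ facets V, u ∈ G → ∀ R ⊆ F, (nb F u \ R).card = 2 → nb F u \ R ⊆ nb V u \ G →
      nb V u \ F ⊆ G := by
    intro G hG huG R hR hcard hsub y hy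
    rw [Finset.mem_sdiff] at hy
    by_contra hyG
    have heq := Finset.eq_of_subset_of_card_le hsub ((hmiss G hG huG).trans hcard.ge)
    have hy' : y ∈ nb F u \ R := by
      rw [heq]
      exact Finset.mem_sdiff.2 ⟨hy.1, hyG⟩
    exact hy.2 (nb_subset (Finset.mem_sdiff.1 hy').1)
  have hR₁d := facet_dim hR₁
  have hR₁nb := card_nb_of_dim_two ((hVF F hF).of_face (facet_isFace hR₁)) (by omega) hu'.1
  obtain ⟨a, b, hab, hR₁ab⟩ := Finset.card_eq_two.1 hR₁nb
  have haR : a ∈ nb R₁ u := by simp [hR₁ab]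
  have hbR : b ∈ nb R₁ u := by simp [hR₁ab]
  have haF : a ∈ nb F u := by
    rw [nb_face (facet_isFace hR₁) hu'.1] at haR
    exact (Finset.mem_inter.1 haR).1
  have hbF : b ∈ nb F u := by
    rw [nb_face (facet_isFace hR₁) hu'.1] at hbR
    exact (Finset.mem_inter.1 hbR).1
  obtain ⟨R₃, hR₃, hauR₃, hbR₃⟩ := exists_facet (mem_nb.1 haF).2.2 (by simp) (nb_subset hbF)
    (by simp [(mem_nb.1 hbF).2.1, hab.symm])
  have huR₃ : u ∈ R₃ := hauR₃ (by simp)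
  obtain ⟨G₃, hG₃, huG₃, hFG₃, hGsub₃⟩ := hother R₃ hR₃ huR₃
  have hR₃d := facet_dim hR₃
  have hR₃nb := card_nb_of_dim_two ((hVF F hF).of_face (facet_isFace hR₃)) (by omega) huR₃
  have h14 := card_nb_face_add (facet_isFace hR₃) huR₃
  have hGo := hout G hG huG R₁ (facet_isFace hR₁).subset (by omega) hGsub
  have hGo₃ := hout G₃ hG₃ huG₃ R₃ (facet_isFace hR₃).subset (by omega) hGsub₃
  have hGG₃ : G ≠ G₃ := by
    rintro rfl
    exact hbR₃ (by rw [← hFG₃, hFG]; exact nb_subset hbR)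
  have huGG : u ∈ G ∩ G₃ := Finset.mem_inter.2 ⟨huG, huG₃⟩
  have hGGf := (facet_isFace hG).inter (facet_isFace hG₃)
  have h15 := hS G hG G₃ hG₃ hGG₃ ⟨u, huGG⟩
  have h16 := card_nb_of_dim_two (hV.of_face hGGf) (by omega) huGG
  have h17 : insert a (nb V u \ F) ⊆ nb (G ∩ G₃) u := by
    rw [nb_face hGGf huGG, Finset.insert_subset_iff]
    refine ⟨?_, fun y hy => ?_⟩
    · rw [nb_face hFf hvF] at haF
      refine Finset.mem_inter.2 ⟨(Finset.mem_inter.1 haF).1, Finset.mem_inter.2 ⟨?_, ?_⟩⟩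
      · have := nb_subset haR
        rw [← hFG] at this
        exact (Finset.mem_inter.1 this).2
      · have : a ∈ R₃ := hauR₃ (by simp)
        rw [← hFG₃] at this
        exact (Finset.mem_inter.1 this).2
    · exact Finset.mem_inter.2 ⟨(Finset.mem_sdiff.1 hy).1, Finset.mem_inter.2 ⟨hGo hy, hGo₃ hy⟩⟩
  have h18 := Finset.card_le_card h17
  rw [Finset.card_insert_of_notMem (by simp [nb_subset haF])] at h18
  omega

/-- The excess degree theorem. -/
theorem le_exc_of_not_simple (n : ℕ) : ∀ {V : Finset E}, ConvPos V → dim V = n + 3 → ¬ Simple V →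
    dim V - 2 ≤ exc V ∧ (Semi V → dim V - 1 ≤ exc V) := by
  induction n with
  | zero =>
    intro V hV hd hns
    refine ⟨le_exc_of_not_semi hV fun hS => hns (hS.simple_of_dim_three hV hd), fun hS => ?_⟩
    exact absurd (hS.simple_of_dim_three hV hd) hns
  | succ n ih =>
    intro V hV hd hns
    have main : Semi V → dim V - 1 ≤ exc V := by
      intro hS
      simp only [Simple, not_forall] at hns
      obtain ⟨v, hv, hvs⟩ := hns
      have ihF : ∀ F ∈ facets V, ¬ Simple F → dim F - 2 ≤ exc F ∧ (Semi F → dim F - 1 ≤ exc F) :=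
        fun F hF => ih (hV.of_face (facet_isFace hF)) (by have := facet_dim hF; omega)
      by_cases hu : ∀ x ∈ V, x ≠ v → (nb V x).card = dim V
      · exact hS.le_exc_of_unique hV (by omega) ihF hv hvs hu
      · push Not at hu
        obtain ⟨w, hw, hwv, hws⟩ := hu
        obtain ⟨G, hG, hvG, hwG⟩ := exists_facet (hV v hv) (by simp) hw (by simpa using hwv)
        have hvG : v ∈ G := hvG (by simp)
        have h1 := (ihF G hG fun hs => hvs (hS.card_nb_of_facet hV hG hvG (hs v hvG))).1
        have h2 := exc_eq_add hV hG
        have h3 := Finset.single_le_sum (f := fun x => (nb V x).card - dim V)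
          (fun i _ => Nat.zero_le _) (Finset.mem_sdiff.2 ⟨hw, hwG⟩)
        have h4 := hS.card_nb_ne hV hw
        have h5 := dim_le_card_nb hV hw
        have h6 := facet_dim hG
        omega
    refine ⟨?_, main⟩
    by_cases hS : Semi V
    · have := main hS
      omega
    · exact le_exc_of_not_semi hV hS

theorem card_sdiff_eq_add {α : Type*} {N V F G : Finset α} (hN : N ⊆ V) :
    (N \ F).card = (N ∩ (G \ (F ∩ G))).card + (N ∩ (V \ (F ∪ G))).card := by
  rw [← Finset.card_union_of_disjoint]
  · congr 1
    ext y
    have := @hN y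
    by_cases hF : y ∈ F <;> by_cases hG : y ∈ G <;> by_cases hy : y ∈ N <;> simp_all
  · rw [Finset.disjoint_left]
    intro y
    by_cases hG : y ∈ G <;> simp_all

theorem card_eq_add_add {α : Type*} {N V F G : Finset α} (hN : N ⊆ V)
    (hNK : ∀ y ∈ N, y ∉ F ∩ G) :
    N.card = (N ∩ (F \ (F ∩ G))).card + (N ∩ (G \ (F ∩ G))).card +
      (N ∩ (V \ (F ∪ G))).card := by
  rw [add_assoc, ← card_sdiff_eq_add hN, ← Finset.card_inter_add_card_sdiff N F]
  congr 2
  ext y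
  have := hNK y
  by_cases hy : y ∈ N <;> simp_all

set_option maxHeartbeats 1000000 in
theorem false_of_exc_eq_four (hV : ConvPos V) (hd : dim V = 6) (he : exc V = 4)
    (hc : V.card = 14 ∨ V.card = 15) (hF : F ∈ facets V) (hG : G ∈ facets V)
    (hne : (F ∩ G).Nonempty) (hdK : dim (F ∩ G) + 3 ≤ dim V) (hle : F.card ≤ G.card) : False := by
  have hFf := facet_isFace hF
  have hGf := facet_isFace hG
  have hFd := facet_dim hF
  have hGd := facet_dim hG
  set K := F ∩ G with hK
  have hKF : K ⊆ F := Finset.inter_subset_left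
  have hKG : K ⊆ G := Finset.inter_subset_right
  have hKV : K ⊆ V := hKF.trans hFf.subset
  have h1 := mul_le_exc_of_inter hV hF hG
  have h2 := dim_lt_card (hV.of_face (hFf.inter hGf)) hne
  rw [← hK] at h1 h2
  rw [hd] at h1 hdK
  rw [he] at h1
  have hj : (dim K = 0 ∧ K.card = 1) ∨ (dim K = 3 ∧ K.card = 4) := by
    have : dim K = 0 ∨ dim K = 1 ∨ dim K = 2 ∨ dim K = 3 := by omega
    rcases this with h | h | h | h <;> rw [h] at h1 h2 <;> omega
  have hsplit : ∑ x ∈ V \ K, ((nb V x).card - dim V) + ∑ x ∈ K, ((nb V x).card - dim V) = 4 := by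
    rw [Finset.sum_sdiff hKV, ← he, exc]
  have hKle : ∀ x ∈ K, 4 - dim K ≤ (nb V x).card - dim V := fun x hx => by
    have := le_card_nb_sub_of_inter hV hF hG hx
    rwa [hd] at this ⊢
  have hKsum : ∑ x ∈ K, (4 - dim K) = 4 := by
    rw [Finset.sum_const, smul_eq_mul]
    rcases hj with ⟨h, h'⟩ | ⟨h, h'⟩ <;> rw [h, h']
  have hKsum' := Finset.sum_le_sum hKle
  have hKeq := (Finset.sum_eq_sum_iff_of_le hKle).1 (by omega)
  have hsimp : ∀ x ∈ V, x ∉ K → (nb V x).card = dim V := by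
    intro x hx hxK
    have h0 : ∑ x ∈ V \ K, ((nb V x).card - dim V) = 0 := by omega
    have h3 := Finset.sum_eq_zero_iff.1 h0 x (Finset.mem_sdiff.2 ⟨hx, hxK⟩)
    have h4 := dim_le_card_nb hV hx
    omega
  have hKnb : ∀ x ∈ K, (nb F x).card = dim F ∧ (nb G x).card = dim G ∧ nb V x ⊆ F ∪ G := by
    intro x hx
    obtain ⟨h3, h4, h5⟩ := inter_bounds hV hF hG hx
    have h6 := card_nb_inter_add_le hF hG hx
    have h7 : (nb V x ∩ (F ∪ G)).card ≤ (nb V x).card :=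
      Finset.card_le_card Finset.inter_subset_left
    have h8 := hKeq x hx
    have h9 := card_nb_face_add ((hFf.inter hGf).restrict hKF hFf.subset) hx
    have h10 := card_nb_face_add ((hFf.inter hGf).restrict hKG hGf.subset) hx
    rw [← hK] at h3 h4 h5 h6 h9 h10
    refine ⟨by omega, by omega, ?_⟩
    rw [← Finset.inter_eq_left]
    exact Finset.eq_of_subset_of_card_le Finset.inter_subset_left (by omega)
  have hFs : Simple F := fun x hx => by
    by_cases hxK : x ∈ K
    · exact (hKnb x hxK).1
    · exact card_nb_face_of_simple hV (hsimp x (hFf.subset hx) hxK) hFf hx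
  have hGs : Simple G := fun x hx => by
    by_cases hxK : x ∈ K
    · exact (hKnb x hxK).2.1
    · exact card_nb_face_of_simple hV (hsimp x (hGf.subset hx) hxK) hGf hx
  obtain ⟨⟨i, hi⟩, hF6, hF8⟩ := hFs.five_card (hV.of_face hFf) (by omega)
  obtain ⟨⟨j, hj'⟩, hG6, hG8⟩ := hGs.five_card (hV.of_face hGf) (by omega)
  set O := V \ (F ∪ G) with hO
  have hOV : O ⊆ V := Finset.sdiff_subset
  have hFK := Finset.card_sdiff_add_card_eq_card hKF
  have hGK := Finset.card_sdiff_add_card_eq_card hKG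
  have hFG := Finset.card_union_add_card_inter F G
  rw [← hK] at hFG
  have hOc := Finset.card_sdiff_add_card_eq_card (Finset.union_subset hFf.subset hGf.subset)
  rw [← hO] at hOc
  have hF' : F \ K ⊆ V := Finset.sdiff_subset.trans hFf.subset
  have hG' : G \ K ⊆ V := Finset.sdiff_subset.trans hGf.subset
  have hsumF : ∑ x ∈ F \ K, ((nb V x ∩ (G \ K)).card + (nb V x ∩ O).card) = (F \ K).card := by
    rw [Finset.card_eq_sum_ones]
    refine Finset.sum_congr rfl fun x hx => ?_
    rw [Finset.mem_sdiff] at hx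
    rw [← card_nb_sdiff_of_simple hV (hsimp x (hFf.subset hx.1) hx.2) hF hx.1, hK, hO,
      ← card_sdiff_eq_add nb_subset]
  have hsumG : ∑ x ∈ G \ K, ((nb V x ∩ (F \ K)).card + (nb V x ∩ O).card) = (G \ K).card := by
    rw [Finset.card_eq_sum_ones]
    refine Finset.sum_congr rfl fun x hx => ?_
    rw [Finset.mem_sdiff] at hx
    rw [← card_nb_sdiff_of_simple hV (hsimp x (hGf.subset hx.1) hx.2) hG hx.1, hK, hO,
      Finset.inter_comm F G, Finset.union_comm F G, ← card_sdiff_eq_add nb_subset]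
  have hKO : ∀ x ∈ K, ∀ y ∈ O, y ∉ nb V x := fun x hx y hy h =>
    (Finset.mem_sdiff.1 hy).2 ((hKnb x hx).2.2 h)
  have hsumO : ∑ x ∈ O, ((nb V x ∩ (F \ K)).card + (nb V x ∩ (G \ K)).card + (nb V x ∩ O).card) =
      6 * O.card := by
    rw [mul_comm]
    refine Finset.sum_const_nat fun x hx => ?_
    have hxK : x ∉ K := fun h =>
      (Finset.mem_sdiff.1 hx).2 (Finset.mem_union_left _ (hKF h))
    rw [← hd, ← hsimp x (hOV hx) hxK]
    exact (card_eq_add_add nb_subset fun y hy hyK =>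
      hKO y hyK x hx (mem_nb_comm (hOV hx) hy)).symm
  rw [Finset.sum_add_distrib] at hsumF hsumG
  rw [Finset.sum_add_distrib, Finset.sum_add_distrib, sum_card_nb_inter_comm hOV hF',
    sum_card_nb_inter_comm hOV hG'] at hsumO
  rw [sum_card_nb_inter_comm hG' hF'] at hsumG
  have hOO : ∑ x ∈ O, (nb V x ∩ O).card ≤ O.card * (O.card - 1) := by
    rw [← smul_eq_mul]
    exact Finset.sum_le_card_nsmul _ _ _ fun x hx => Nat.le_sub_one_of_lt (card_nb_inter_le hx)
  rcases hj with ⟨hj, hKc⟩ | ⟨hj, hKc⟩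
  · have : O.card = 0 ∨ O.card = 3 ∨ O.card = 4 := by omega
    rcases this with h | h | h <;> rw [h] at hOO <;> omega
  · by_cases hGc : G.card = 6
    · obtain ⟨a, ha, b, hb, hab⟩ := exists_adj_of_separator hV (A := K)
        (S := (F \ K) ∪ (G \ K)) (B := O)
        (by
          ext z
          have h3 : z ∈ F → z ∈ V := fun h => hFf.subset h
          have h4 : z ∈ G → z ∈ V := fun h => hGf.subset h
          simp only [hK, hO, Finset.mem_union, Finset.mem_inter, Finset.mem_sdiff]
          tauto)
        (Finset.disjoint_left.2 fun z hz => by simp [hO, hKF hz])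
        (by
          have := Finset.card_union_le (F \ K) (G \ K)
          omega)
        hne (Finset.card_pos.1 (by omega))
      exact hKO a ha b hb hab
    · by_cases hO1 : O.card = 1
      · obtain ⟨o, ho⟩ := Finset.card_eq_one.1 hO1
        have hoO : o ∈ O := by simp [ho]
        have hoG : o ∉ G := fun h => (Finset.mem_sdiff.1 hoO).2 (Finset.mem_union_right _ h)
        have hoF : o ∉ F := fun h => (Finset.mem_sdiff.1 hoO).2 (Finset.mem_union_left _ h)
        obtain ⟨z, hz⟩ := Finset.card_pos.1 (by omega : 0 < (F \ K).card)
        have hz' := Finset.mem_sdiff.1 hz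
        obtain ⟨y, hy, hyG⟩ := exists_nb_notMem_facet hV hGf (hOV hoO) hoG (hFf.subset hz'.1)
          (fun h => hz'.2 (Finset.mem_inter.2 ⟨hz'.1, h⟩)) (by rintro rfl; exact hoF hz'.1)
        have hyF : y ∈ F \ K := by
          have hyO : y ∉ O := by
            rw [ho, Finset.mem_singleton]
            exact (mem_nb.1 hy).2.1
          have hyV := nb_subset hy
          simp only [hK, hO, Finset.mem_union, Finset.mem_inter, Finset.mem_sdiff] at hyO ⊢
          tauto
        have h3 := Finset.single_le_sum (f := fun x => (nb V x ∩ O).card)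
          (fun i _ => Nat.zero_le _) hyF
        have h4 : 0 < (nb V y ∩ O).card := Finset.card_pos.2
          ⟨o, Finset.mem_inter.2 ⟨mem_nb_comm (hOV hoO) hy, hoO⟩⟩
        rw [hO1] at hOO
        omega
      · have hO3 : O.card = 0 ∨ O.card = 2 ∨ O.card = 3 := by omega
        clear hKsum hKsum' hKeq hsplit hle hF6 hF8 hG6 hG8 h1 h2 hdK hFd hGd hKle he hd hj
        rcases hO3 with h | h | h <;> rw [h] at hOO hsumO hOc
        · have hO0 : O = ∅ := Finset.card_eq_zero.1 h
          simp only [hO0, Finset.inter_empty, Finset.card_empty, Finset.sum_const_zero]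
            at hsumF hsumG
          omega
        · omega
        · omega

theorem exc_ne_four (hV : ConvPos V) (hd : dim V = 6) (hc : V.card = 14 ∨ V.card = 15) :
    exc V ≠ 4 := by
  intro he
  have hns : ¬ Simple V := fun hs => by
    have := exc_eq_zero_of_simple hs
    omega
  have hnS : ¬ Semi V := fun hS => by
    have := (le_exc_of_not_simple 3 hV hd hns).2 hS
    omega
  obtain ⟨F, hF, G, hG, -, hne, hdK⟩ := exists_of_not_semi hnS
  rcases le_total F.card G.card with h | h
  · exact false_of_exc_eq_four hV hd he hc hF hG hne hdK h
  · rw [Finset.inter_comm] at hne hdK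
    exact false_of_exc_eq_four hV hd he hc hG hF hne hdK h

theorem sum_card_nb_ne (hV : ConvPos V) (hd : dim V = 6) {p q : ℕ} (hp : V.card = p)
    (hpq : (p, q) ∈ [(13, 39), (14, 42), (14, 44), (15, 47), (18, 54), (19, 57)]) :
    ∑ v ∈ V, (nb V v).card ≠ 2 * q := by
  intro hq
  rw [sum_card_nb_eq_exc hV, hd, hp] at hq
  simp only [List.mem_cons, Prod.mk.injEq, List.not_mem_nil, or_false] at hpq
  by_cases h0 : exc V = 0
  · have h1 := (simple_of_exc_eq_zero hV h0).six_card_ne hV hd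
    have h2 := (simple_of_exc_eq_zero hV h0).six_card_ne' hV hd
    omega
  · have := exc_ne_four hV hd
    omega

end Excess

section ConvexHull

variable {E : Type*} [NormedAddCommGroup E] [NormedSpace ℝ E] {A : Set E} {V F : Finset E}
  {v w x : E}

theorem exists_convexHull_extremePoints (S : Finset E) :
    ∃ V : Finset E, (V : Set E) = (convexHull ℝ (S : Set E)).extremePoints ℝ ∧
      convexHull ℝ (V : Set E) = convexHull ℝ (S : Set E) := by
  have hfin : ((convexHull ℝ (S : Set E)).extremePoints ℝ).Finite :=
    S.finite_toSet.subset extremePoints_convexHull_subset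
  refine ⟨hfin.toFinset, hfin.coe_toFinset, ?_⟩
  rw [hfin.coe_toFinset]
  exact (hfin.isCompact_convexHull ℝ).isClosed.closure_eq.symm.trans
    (closure_convexHull_extremePoints (S.finite_toSet.isCompact_convexHull ℝ)
      (convex_convexHull ℝ _))

/-- Separation of the affine span of `F` from the convex hull of the other points. -/
theorem isFace_of_disjoint (hF : F.Nonempty) (hFV : F ⊆ V)
    (hdisj : Disjoint (convexHull ℝ ((V \ F : Finset E) : Set E))
      (affineSpan ℝ (F : Set E) : Set E)) :
    IsFace V F := by
  have : FiniteDimensional ℝ (affineSpan ℝ (F : Set E)).direction := by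
    rw [direction_affineSpan]
    exact finiteDimensional_vectorSpan_of_finite ℝ F.finite_toSet
  obtain ⟨f, a, b, hfa, hab, hfb⟩ := geometric_hahn_banach_compact_closed
    (convex_convexHull ℝ _) ((V \ F).finite_toSet.isCompact_convexHull ℝ)
    (affineSpan ℝ (F : Set E)).convex
    (AffineSubspace.closed_of_finiteDimensional (affineSpan ℝ (F : Set E))) hdisj
  obtain ⟨v, hv⟩ := hF
  have hconst : ∀ w ∈ F, f w = f v := by
    intro w hw
    by_contra hne
    have hmem := AffineMap.lineMap_mem (Q := affineSpan ℝ (F : Set E)) ((b - f v) / (f w - f v))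
      (subset_affineSpan ℝ _ hv) (subset_affineSpan ℝ _ hw)
    have h := hfb _ hmem
    rw [AffineMap.lineMap_apply_module', map_add, map_smul, map_sub, smul_eq_mul,
      div_mul_cancel₀ _ (sub_ne_zero.2 hne)] at h
    linarith
  have hlt : ∀ w ∈ V, w ∉ F → f w < f v := fun w hw hwF =>
    ((hfa w (subset_convexHull ℝ _ (by simp [hw, hwF]))).trans hab).trans
      (hfb v (subset_affineSpan ℝ _ hv))
  refine ⟨f, f v, fun w hw => ?_, fun w => ⟨fun hw => ⟨hFV hw, hconst w hw⟩, fun hw => ?_⟩⟩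
  · by_cases hwF : w ∈ F
    · exact (hconst w hwF).le
    · exact (hlt w hw hwF).le
  · by_contra hwF
    exact (hlt w hw.1 hwF).ne hw.2

theorem convPos_of_extremePoints
    (hV : ∀ v ∈ V, v ∈ (convexHull ℝ (V : Set E)).extremePoints ℝ) : ConvPos V := by
  intro v hv
  refine isFace_of_disjoint (Finset.singleton_nonempty v) (by simpa using hv) ?_
  rw [Finset.coe_singleton, AffineSubspace.coe_affineSpan_singleton, disjoint_singleton_right]
  intro h
  have hconv := (((convex_convexHull ℝ _).mem_extremePoints_iff_convex_sdiff).1 (hV v hv)).2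
  refine (convexHull_min ?_ hconv h).2 rfl
  intro w hw
  rw [Finset.mem_coe, Finset.mem_sdiff, Finset.mem_singleton] at hw
  exact ⟨subset_convexHull ℝ _ hw.1, hw.2⟩

theorem isExtreme_convexHull_of_isFace (hF : IsFace V F) :
    IsExtreme ℝ (convexHull ℝ (V : Set E)) (convexHull ℝ (F : Set E)) := by
  obtain ⟨φ, c, hφ, hF⟩ := hF
  have hFV : (F : Set E) ⊆ V := fun x hx => ((hF x).1 hx).1
  have hle : ∀ x ∈ convexHull ℝ (V : Set E), φ x ≤ c :=
    fun x hx => convexHull_min (t := {x | φ x ≤ c}) hφ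
      (convex_halfSpace_le φ.isLinear c) hx
  have heq : ∀ x ∈ convexHull ℝ (F : Set E), φ x = c :=
    fun x hx => convexHull_min (t := {x | φ x = c}) (fun y hy => ((hF y).1 hy).2)
      (convex_hyperplane φ.isLinear c) hx
  refine ⟨convexHull_mono hFV, ?_⟩
  rintro x hx y hy z hz ⟨a, b, ha, hb, hab, rfl⟩
  have hxc : φ x = c := by
    have h1 := heq _ hz
    rw [map_add, map_smul, map_smul, smul_eq_mul, smul_eq_mul] at h1
    have h2 := hle x hx
    have h3 := hle y hy
    have h4 : a * φ x = a * c := by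
      have h5 : a * φ x ≤ a * c := by gcongr
      have h6 : b * φ y ≤ b * c := by gcongr
      have h7 : a * c + b * c = c := by rw [← add_mul, hab, one_mul]
      linarith
    exact mul_left_cancel₀ ha.ne' h4
  obtain ⟨k, hk0, hk1, rfl⟩ := Finset.mem_convexHull'.1 hx
  have hsum : ∑ y ∈ V, k y * (c - φ y) = 0 := by
    simp only [map_sum, map_smul, smul_eq_mul] at hxc
    simp only [mul_sub, Finset.sum_sub_distrib, ← Finset.sum_mul, hk1, hxc]
    ring
  have hzero : ∀ y ∈ V, y ∉ F → k y = 0 := by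
    intro y hy hyF
    have h := (Finset.sum_eq_zero_iff_of_nonneg fun y hy =>
      mul_nonneg (hk0 y hy) (sub_nonneg.2 (hφ y hy))).1 hsum y hy
    refine (mul_eq_zero.1 h).resolve_right fun h' => hyF ((hF y).2 ⟨hy, ?_⟩)
    linarith
  refine Finset.mem_convexHull'.2 ⟨k, fun y hy => hk0 y (hFV hy), ?_, ?_⟩
  · rw [← hk1]
    exact Finset.sum_subset hFV fun y hy hyF => hzero y hy hyF
  · exact Finset.sum_subset hFV fun y hy hyF => by rw [hzero y hy hyF, zero_smul]

theorem mem_of_mem_convexHull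
    (hV : ∀ v ∈ V, v ∈ (convexHull ℝ (V : Set E)).extremePoints ℝ) (hv : v ∈ V)
    (hFV : F ⊆ V) (hvF : v ∈ convexHull ℝ (F : Set E)) : v ∈ F := by
  have h : v ∈ (convexHull ℝ (F : Set E)).extremePoints ℝ :=
    inter_extremePoints_subset_extremePoints_of_subset
      (convexHull_mono (Finset.coe_subset.2 hFV)) ⟨hvF, hV v hv⟩
  exact extremePoints_convexHull_subset h

/-- An extreme convex subset of a polytope is the convex hull of the vertices it contains. -/
theorem convexHull_filter_of_isExtreme
    (hA : IsExtreme ℝ (convexHull ℝ (V : Set E)) A) (hAc : Convex ℝ A) :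
    convexHull ℝ ((V.filter (· ∈ A) : Finset E) : Set E) = A := by
  set W := V.filter (· ∈ A) with hW
  have hd : convexHull ℝ ((V \ W : Finset E) : Set E) ⊆ convexHull ℝ (V : Set E) \ A :=
    convexHull_min (fun x hx => by
      rw [Finset.mem_coe, Finset.mem_sdiff] at hx
      exact ⟨subset_convexHull ℝ _ hx.1, fun h => hx.2 (Finset.mem_filter.2 ⟨hx.1, h⟩)⟩)
      (hA.convex_sdiff (convex_convexHull ℝ _))
  have hWA : convexHull ℝ (W : Set E) ⊆ A :=
    convexHull_min (fun x hx => (Finset.mem_filter.1 hx).2) hAc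
  refine hWA.antisymm fun x hx => ?_
  have hxV := hA.subset hx
  have hVW : (V : Set E) = (W : Set E) ∪ ((V \ W : Finset E) : Set E) := by
    rw [← Finset.coe_union, Finset.union_sdiff_of_subset (Finset.filter_subset _ _)]
  rcases W.eq_empty_or_nonempty with hW0 | hWn
  · rw [hW0, Finset.sdiff_empty] at hd
    exact absurd hx (hd hxV).2
  rcases (V \ W).eq_empty_or_nonempty with hD0 | hDn
  · rw [hD0, Finset.coe_empty, union_empty] at hVW
    rwa [← hVW]
  rw [hVW, convexHull_union (by simpa using hWn) (by exact_mod_cast hDn), mem_convexJoin] at hxV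
  obtain ⟨a, ha, b, hb, hab⟩ := hxV
  have hb' := hd hb
  rw [← insert_endpoints_openSegment] at hab
  rcases hab with rfl | rfl | hab
  · exact ha
  · exact absurd hx hb'.2
  · refine absurd (hA.left_mem_of_mem_openSegment hb'.1 (hA.subset (hWA ha)) hx ?_) hb'.2
    rwa [openSegment_symm]

theorem eq_or_eq_of_wbtw {P : Set E} (hv : v ∈ P.extremePoints ℝ) (hw : w ∈ P) (hx : x ∈ P)
    (h : Wbtw ℝ w v x) : w = v ∨ x = v :=
  (mem_extremePoints_iff_forall_segment.1 hv).2 w hw x hx (mem_segment_iff_wbtw.2 h)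

theorem exists_isFace_of_edge
    (hV : ∀ v ∈ V, v ∈ (convexHull ℝ (V : Set E)).extremePoints ℝ)
    (hA : IsExtreme ℝ (convexHull ℝ (V : Set E)) A) (hAc : Convex ℝ A)
    (hA1 : finrank ℝ (vectorSpan ℝ A) = 1) :
    ∃ F ∈ (V.powersetCard 2).filter fun F => IsFace V F, convexHull ℝ (F : Set E) = A := by
  have hWA := convexHull_filter_of_isExtreme hA hAc
  set W := V.filter (· ∈ A) with hW
  have hWV : W ⊆ V := Finset.filter_subset _ _
  have hspan : finrank ℝ (vectorSpan ℝ (W : Set E)) = 1 := by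
    rw [← hA1, ← hWA, ← direction_affineSpan, ← direction_affineSpan, affineSpan_convexHull]
  obtain ⟨v, hv, w, hw, hvw⟩ : ∃ v ∈ W, ∃ w ∈ W, v ≠ w := by
    by_contra! h
    have hs : (W : Set E).Subsingleton := fun x hx y hy => h x hx y hy
    rw [vectorSpan_of_subsingleton ℝ hs, finrank_bot] at hspan
    exact zero_ne_one hspan
  have hcol : Collinear ℝ (W : Set E) := by
    have := finiteDimensional_vectorSpan_of_finite ℝ W.finite_toSet
    exact collinear_iff_finrank_le_one.2 hspan.le
  have hWe : W = {v, w} := by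
    refine Finset.Subset.antisymm (fun u hu => ?_)
      (Finset.insert_subset hv (Finset.singleton_subset_iff.2 hw))
    have hc : Collinear ℝ {v, w, u} := hcol.subset (by
      rintro y (rfl | rfl | rfl) <;> assumption)
    have hP : ∀ {y}, y ∈ W → y ∈ convexHull ℝ (V : Set E) :=
      fun hy => subset_convexHull ℝ _ (hWV hy)
    rw [Finset.mem_insert, Finset.mem_singleton]
    rcases hc.wbtw_or_wbtw_or_wbtw with h | h | h
    · rcases eq_or_eq_of_wbtw (hV w (hWV hw)) (hP hv) (hP hu) h with h | h
      · exact absurd h hvw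
      · exact Or.inr h
    · rcases eq_or_eq_of_wbtw (hV u (hWV hu)) (hP hw) (hP hv) h with h | h
      · exact Or.inr h.symm
      · exact Or.inl h.symm
    · rcases eq_or_eq_of_wbtw (hV v (hWV hv)) (hP hu) (hP hw) h with h | h
      · exact Or.inl h
      · exact absurd h.symm hvw
  have hd : convexHull ℝ ((V \ W : Finset E) : Set E) ⊆ convexHull ℝ (V : Set E) \ A :=
    convexHull_min (fun x hx => by
      rw [Finset.mem_coe, Finset.mem_sdiff] at hx
      exact ⟨subset_convexHull ℝ _ hx.1, fun h => hx.2 (Finset.mem_filter.2 ⟨hx.1, h⟩)⟩)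
      (hA.convex_sdiff (convex_convexHull ℝ _))
  refine ⟨W, Finset.mem_filter.2 ⟨Finset.mem_powersetCard.2 ⟨hWV, ?_⟩, ?_⟩, hWA⟩
  · rw [hWe, Finset.card_pair hvw]
  refine isFace_of_disjoint ⟨v, hv⟩ hWV (Set.disjoint_left.2 fun z hz hzl => ?_)
  have hzP := hd hz
  have hvA : v ∈ A := (Finset.mem_filter.1 hv).2
  have hwA : w ∈ A := (Finset.mem_filter.1 hw).2
  rw [hWe, Finset.coe_pair] at hzl
  rcases (collinear_insert_of_mem_affineSpan_pair hzl).wbtw_or_wbtw_or_wbtw with h | h | h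
  · rcases eq_or_eq_of_wbtw (hV v (hWV hv)) hzP.1 (hA.subset hwA) h with rfl | h
    · exact hzP.2 hvA
    · exact hvw h.symm
  · rcases eq_or_eq_of_wbtw (hV w (hWV hw)) (hA.subset hvA) hzP.1 h with h | rfl
    · exact hvw h
    · exact hzP.2 hwA
  · exact hzP.2 (hAc.segment_subset hwA hvA (mem_segment_iff_wbtw.2 h))

theorem finrank_vectorSpan_convexHull_pair (h : v ≠ w) :
    finrank ℝ (vectorSpan ℝ (convexHull ℝ ({v, w} : Set E))) = 1 := by
  rw [← direction_affineSpan, affineSpan_convexHull, direction_affineSpan, vectorSpan_pair]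
  exact finrank_span_singleton (sub_ne_zero.2 h)

/-- The one-dimensional extreme convex subsets of a polytope correspond to the pairs of vertices
that are faces. -/
theorem ncard_edges (hV : ∀ v ∈ V, v ∈ (convexHull ℝ (V : Set E)).extremePoints ℝ) :
    {A : Set E | IsExtreme ℝ (convexHull ℝ (V : Set E)) A ∧ Convex ℝ A ∧
      finrank ℝ (vectorSpan ℝ A) = 1}.ncard =
      ((V.powersetCard 2).filter fun F => IsFace V F).card := by
  rw [← Set.ncard_coe_finset, ← Set.InjOn.ncard_image (f := fun F : Finset E =>
    convexHull ℝ (F : Set E))]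
  · congr 1
    ext A
    constructor
    · rintro ⟨h1, h2, h3⟩
      exact exists_isFace_of_edge hV h1 h2 h3
    · rintro ⟨F, hF, rfl⟩
      rw [Finset.mem_coe, Finset.mem_filter, Finset.mem_powersetCard] at hF
      obtain ⟨v, w, hvw, rfl⟩ := Finset.card_eq_two.1 hF.1.2
      refine ⟨isExtreme_convexHull_of_isFace hF.2, convex_convexHull ℝ _, ?_⟩
      change finrank ℝ (vectorSpan ℝ (convexHull ℝ (({v, w} : Finset E) : Set E))) = 1
      rw [Finset.coe_pair]
      exact finrank_vectorSpan_convexHull_pair hvw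
  · intro F hF G hG h
    rw [Finset.mem_coe, Finset.mem_filter, Finset.mem_powersetCard] at hF hG
    replace h : convexHull ℝ (F : Set E) = convexHull ℝ (G : Set E) := h
    refine Finset.Subset.antisymm (fun x hx => ?_) fun x hx => ?_
    · refine mem_of_mem_convexHull hV (hF.1.1 hx) hG.1.1 ?_
      rw [← h]
      exact subset_convexHull ℝ _ hx
    · refine mem_of_mem_convexHull hV (hG.1.1 hx) hF.1.1 ?_
      rw [h]
      exact subset_convexHull ℝ _ hx

end ConvexHull

end VPoly

theorem notMem_fPairs_six {p q : ℕ}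
    (hpq : (p, q) ∈ [(13, 39), (14, 42), (14, 44), (15, 47), (18, 54), (19, 57)]) :
    (p, q) ∉ fPairs 6 := by
  rintro ⟨n, P, ⟨⟨S, rfl⟩, hd⟩, h0, h1⟩
  obtain ⟨V, hV, hVS⟩ := VPoly.exists_convexHull_extremePoints S
  rw [adim, ← hVS, ← direction_affineSpan, affineSpan_convexHull, direction_affineSpan] at hd
  rw [f₀, ← hV, Set.ncard_coe_finset] at h0
  have hext : ∀ v ∈ V, v ∈ (convexHull ℝ (V : Set (Fin n → ℝ))).extremePoints ℝ := by
    intro v hv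
    rw [hVS, ← hV]
    exact hv
  refine VPoly.sum_card_nb_ne (VPoly.convPos_of_extremePoints hext) hd h0 hpq ?_
  rw [VPoly.sum_card_nb_eq, ← VPoly.ncard_edges hext, hVS]
  exact congrArg _ h1

/-- None of the pairs `(13,39), (14,42), (14,44), (15,47), (18,54), (19,57)` is
realized by a 6-polytope. -/
theorem stmt8 :
    (13, 39) ∉ fPairs 6 ∧ (14, 42) ∉ fPairs 6 ∧ (14, 44) ∉ fPairs 6 ∧
    (15, 47) ∉ fPairs 6 ∧ (18, 54) ∉ fPairs 6 ∧ (19, 57) ∉ fPairs 6 := by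
  refine ⟨?_, ?_, ?_, ?_, ?_, ?_⟩ <;> exact notMem_fPairs_six (by simp)
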